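/- arXiv:1406.6007 — 6 statements merged into one kernel-verified Lean document; each statement's English description precedes it below -/
import Mathlib

section
/- Let G be a group, K a positive integer, and A ⊆ G a K-approximate subgroup. Let μ be a finitely additive measure on the subsets of G, invariant under left translation by every element of the subgroup ⟨A⟩ generated by A, with μ(A) = 1. If there is a constant C such that μ(A^n) ≤ C for all n, then there exists n < ω with A^n = ⟨A⟩. -/
open scoped Pointwise ENNReal

/-- A subset of a group is symmetric if it contains 1 and is closed under inverse. -/
def IsSymmetric {G : Type*} [Group G] (A : Set G) : Prop :=
  (1 : G) ∈ A ∧ ∀ a ∈ A, a⁻¹ ∈ A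

/-- A symmetric subset `A` is a `K`-approximate subgroup if `A·A ⊆ E·A`
for some finite `E` with `|E| ≤ K`. -/
def IsApproxSubgroup {G : Type*} [Group G] (K : ℕ) (A : Set G) : Prop :=
  IsSymmetric A ∧ ∃ E : Finset G, E.card ≤ K ∧ A * A ⊆ (E : Set G) * A

/-- A finitely additive measure on all subsets of `G`, with values in `[0,∞]`. -/
def IsFinAddMeasure {G : Type*} [Group G] (μ : Set G → ℝ≥0∞) : Prop :=
  μ ∅ = 0 ∧ ∀ X Y : Set G, Disjoint X Y → μ (X ∪ Y) = μ X + μ Y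

theorem aux_pow_mono {G : Type*} [Group G] {A : Set G} (h1 : (1 : G) ∈ A) {m n : ℕ} (h : m ≤ n) :
    A ^ m ⊆ A ^ n := Set.pow_subset_pow_right h1 h

theorem aux_mem_pow {G : Type*} [Group G] {A : Set G} (hA : IsSymmetric A) {g : G}
    (hg : g ∈ Subgroup.closure A) : ∃ n : ℕ, g ∈ A ^ n := by
  have hAi : A⁻¹ = A := by
    ext x
    constructor
    · intro hx
      have := hA.2 _ hx
      simpa using this
    · intro hx
      exact hA.2 _ hx
  induction hg using Subgroup.closure_induction with
  | mem x hx => exact ⟨1, by simpa using hx⟩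
  | one => exact ⟨0, by simp⟩
  | mul x y _ _ hx hy =>
    obtain ⟨m, hm⟩ := hx
    obtain ⟨n, hn⟩ := hy
    exact ⟨m + n, by rw [pow_add]; exact Set.mul_mem_mul hm hn⟩
  | inv x _ hx =>
    obtain ⟨m, hm⟩ := hx
    refine ⟨m, ?_⟩
    rw [← hAi, inv_pow]
    simpa using hm

theorem aux_pow_sub {G : Type*} [Group G] (A : Set G) (n : ℕ) :
    A ^ n ⊆ (Subgroup.closure A : Set G) := by
  induction n with
  | zero => simp
  | succ n ih =>
    rw [pow_succ]
    rintro _ ⟨x, hx, y, hy, rfl⟩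
    exact Subgroup.mul_mem _ (ih hx) (Subgroup.subset_closure hy)

theorem aux_finset_pow {G : Type*} [Group G] {A : Set G} (hA : IsSymmetric A) (F : Finset G)
    (hF : ∀ g ∈ F, g ∈ Subgroup.closure A) : ∃ n : ℕ, ∀ g ∈ F, g ∈ A ^ n := by
  classical
  induction F using Finset.induction_on with
  | empty => exact ⟨0, by simp⟩
  | insert a s _ ih =>
    obtain ⟨n, hn⟩ := ih (fun g hg => hF g (Finset.mem_insert_of_mem hg))
    obtain ⟨m, hm⟩ := aux_mem_pow hA (hF a (Finset.mem_insert_self _ _))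
    refine ⟨max m n, fun g hg => ?_⟩
    rcases Finset.mem_insert.1 hg with rfl | hg
    · exact aux_pow_mono hA.1 (le_max_left _ _) hm
    · exact aux_pow_mono hA.1 (le_max_right _ _) (hn g hg)

theorem aux_measure {G : Type*} [Group G] {A : Set G} {μ : Set G → ℝ≥0∞}
    (hμ : IsFinAddMeasure μ)
    (hinv : ∀ g ∈ Subgroup.closure A, ∀ X : Set G, μ (g • X) = μ X)
    (hμA : μ A = 1) (F : Finset G) (hF : ∀ g ∈ F, g ∈ Subgroup.closure A)
    (hd : ∀ f ∈ F, ∀ g ∈ F, f ≠ g → Disjoint (f • A) (g • A)) :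
    μ (⋃ f ∈ F, f • A) = F.card := by
  classical
  induction F using Finset.induction_on with
  | empty => simp [hμ.1]
  | insert a s ha ih =>
    rw [Finset.set_biUnion_insert, hμ.2, ih, hinv a (hF a (Finset.mem_insert_self _ _)), hμA,
      Finset.card_insert_of_notMem ha]
    · push_cast
      rw [add_comm]
    · exact fun g hg => hF g (Finset.mem_insert_of_mem hg)
    · exact fun f hf g hg => hd f (Finset.mem_insert_of_mem hf) g (Finset.mem_insert_of_mem hg)
    · simp only [Set.disjoint_iUnion_right]
      intro g hg
      refine hd a (Finset.mem_insert_self _ _) g (Finset.mem_insert_of_mem hg) ?_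
      rintro rfl
      exact ha hg

theorem aux_mono {G : Type*} [Group G] {μ : Set G → ℝ≥0∞} (hμ : IsFinAddMeasure μ)
    {X Y : Set G} (h : X ⊆ Y) : μ X ≤ μ Y := by
  rw [← Set.union_sdiff_cancel h, hμ.2 _ _ Set.disjoint_sdiff_right]
  exact le_self_add

/-- If `A` is a `K`-approximate subgroup carrying a finitely additive measure invariant
under left translation by elements of `⟨A⟩` with `μ(A) = 1`, and the measures `μ(Aⁿ)` are
uniformly bounded by a (finite) constant, then `Aⁿ = ⟨A⟩` for some `n`. -/
theorem approx_bounded_powers_generate {G : Type*} [Group G] (K : ℕ) (hK : 0 < K)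
    (A : Set G) (hA : IsApproxSubgroup K A) (μ : Set G → ℝ≥0∞)
    (hμ : IsFinAddMeasure μ)
    (hinv : ∀ g ∈ Subgroup.closure A, ∀ X : Set G, μ (g • X) = μ X)
    (hμA : μ A = 1)
    (C : ℝ≥0∞) (hC : C ≠ ⊤) (hbound : ∀ n : ℕ, μ (A ^ n) ≤ C) :
    ∃ n : ℕ, A ^ n = (Subgroup.closure A : Set G) := by
  classical
  obtain ⟨N, hN⟩ := ENNReal.exists_nat_gt hC
  have hS := hA.1
  let P : ℕ → Prop := fun k => ∃ F : Finset G, F.card = k ∧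
    (∀ g ∈ F, g ∈ Subgroup.closure A) ∧
    ∀ f ∈ F, ∀ g ∈ F, f ≠ g → Disjoint (f • A) (g • A)
  have hP : ∀ k, P k → k ≤ N := by
    rintro k ⟨F, rfl, hF, hd⟩
    obtain ⟨n, hn⟩ := aux_finset_pow hS F hF
    have h1 := aux_measure hμ hinv hμA F hF hd
    have h2 : (⋃ f ∈ F, f • A) ⊆ A ^ (n + 1) := by
      rw [pow_succ]
      refine Set.iUnion₂_subset fun f hf => ?_
      rintro _ ⟨a, ha, rfl⟩
      exact Set.mul_mem_mul (hn f hf) ha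
    have h3 := ((h1 ▸ aux_mono hμ h2).trans (hbound _)).trans hN.le
    exact_mod_cast h3
  have hP0 : P 0 := ⟨∅, by simp⟩
  obtain ⟨F, hFc, hF, hd⟩ : P (Nat.findGreatest P N) := Nat.findGreatest_spec (Nat.zero_le _) hP0
  obtain ⟨n, hn⟩ := aux_finset_pow hS F hF
  refine ⟨n + 1 + 1, (aux_pow_sub A _).antisymm fun g hg => ?_⟩
  have key : ∃ f ∈ F, ¬ Disjoint (g • A) (f • A) := by
    by_contra! hcon
    have hgF : g ∉ F := by
      intro h
      have := hcon g h
      rw [disjoint_self] at this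
      have h1 : g • (1 : G) ∈ g • A := Set.smul_mem_smul_set hS.1
      rw [this] at h1
      exact h1
    have hP1 : P (Nat.findGreatest P N + 1) := by
      refine ⟨insert g F, by rw [Finset.card_insert_of_notMem hgF, hFc], ?_, ?_⟩
      · intro x hx
        rcases Finset.mem_insert.1 hx with rfl | hx
        · exact hg
        · exact hF x hx
      · intro x hx y hy hxy
        rcases Finset.mem_insert.1 hx with rfl | hx2 <;>
          rcases Finset.mem_insert.1 hy with rfl | hy2
        · exact absurd rfl hxy
        · exact hcon y hy2
        · exact (hcon x hx2).symm
        · exact hd x hx2 y hy2 hxy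
    have := Nat.le_findGreatest (hP _ hP1) hP1
    omega
  obtain ⟨f, hf, hfg⟩ := key
  obtain ⟨_, ⟨a, ha, rfl⟩, ⟨b, hb, hab⟩⟩ := Set.not_disjoint_iff.1 hfg
  have hge : g = f * b * a⁻¹ := by
    simp only [smul_eq_mul] at hab
    rw [hab]
    group
  rw [hge, pow_succ, pow_succ]
  exact Set.mul_mem_mul (Set.mul_mem_mul (hn f hf) hb) (hS.2 a ha)
end

section
/- (Ruzsa's covering lemma.) Let G be a group, μ a finitely additive left-translation-invariant measure on the subsets of G, K a positive integer, and X, Y ⊆ G subsets with 0 < μ(Y) < ∞ and μ(XY) ≤ K·μ(Y). Then there is a finite set Z ⊆ X with |Z| ≤ K such that X ⊆ Z·(Y·Y⁻¹). -/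
open scoped Pointwise ENNReal

lemma measure_biUnion_smul {G : Type*} [Group G] (μ : Set G → ℝ≥0∞) (hμ : IsFinAddMeasure μ)
    (hinv : ∀ (g : G) (X : Set G), μ (g • X) = μ X) (Y : Set G) (Z : Finset G)
    (hZ : (Z : Set G).PairwiseDisjoint (fun z => z • Y)) :
    μ (⋃ z ∈ Z, z • Y) = (Z.card : ℝ≥0∞) * μ Y := by
  classical
  induction Z using Finset.induction_on with
  | empty => simpa using hμ.1
  | insert a s ha ih =>
    rw [Finset.set_biUnion_insert, hμ.2, hinv, ih, Finset.card_insert_of_notMem ha]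
    · push_cast
      ring
    · exact hZ.subset (by simp)
    · rw [Set.disjoint_iUnion₂_right]
      intro z hz
      exact hZ (by simp) (by simp [hz]) (fun h => ha (h ▸ hz))

/-- Ruzsa's covering lemma: if `μ(XY) ≤ K·μ(Y)` with `0 < μ(Y) < ∞`, then `X` is covered
by at most `K` left translates of `Y·Y⁻¹` by elements of `X`. -/
theorem ruzsa_covering {G : Type*} [Group G] (K : ℕ) (hK : 0 < K)
    (μ : Set G → ℝ≥0∞) (hμ : IsFinAddMeasure μ)
    (hinv : ∀ (g : G) (X : Set G), μ (g • X) = μ X)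
    (X Y : Set G) (hY0 : 0 < μ Y) (hYtop : μ Y ≠ ⊤)
    (hXY : μ (X * Y) ≤ (K : ℝ≥0∞) * μ Y) :
    ∃ Z : Finset G, (Z : Set G) ⊆ X ∧ Z.card ≤ K ∧ X ⊆ (Z : Set G) * (Y * Y⁻¹) := by
  classical
  have hmono : ∀ A B : Set G, A ⊆ B → μ A ≤ μ B := by
    intro A B hAB
    have h := hμ.2 A (B \ A) Set.disjoint_sdiff_right
    rw [Set.union_diff_cancel hAB] at h
    rw [h]
    exact le_self_add
  let P : ℕ → Prop := fun n => ∃ Z : Finset G, (Z : Set G) ⊆ X ∧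
    (Z : Set G).PairwiseDisjoint (fun z => z • Y) ∧ Z.card = n
  have hbound : ∀ n, P n → n ≤ K := by
    rintro n ⟨Z, hZX, hZ, rfl⟩
    have h1 : (Z.card : ℝ≥0∞) * μ Y ≤ K * μ Y := by
      rw [← measure_biUnion_smul μ hμ hinv Y Z hZ]
      refine (hmono _ _ ?_).trans hXY
      refine Set.iUnion₂_subset fun z hz => ?_
      exact Set.smul_set_subset_mul (hZX hz)
    have h2 := (ENNReal.mul_le_mul_iff_left hY0.ne' hYtop).1 h1
    exact_mod_cast h2
  have hP0 : P 0 := ⟨∅, by simp, by simp, by simp⟩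
  have hmax : P (Nat.findGreatest P K) := Nat.findGreatest_spec (Nat.zero_le K) hP0
  obtain ⟨Z, hZX, hZ, hcard⟩ := hmax
  refine ⟨Z, hZX, hcard ▸ Nat.findGreatest_le K, ?_⟩
  intro x hx
  by_contra hnot
  have hdis : ∀ z ∈ Z, Disjoint (x • Y) (z • Y) := by
    intro z hz
    rw [Set.disjoint_left]
    rintro _ ⟨y, hy, rfl⟩ ⟨y', hy', h⟩
    apply hnot
    refine ⟨z, hz, y' * y⁻¹, ⟨y', hy', y⁻¹, by simpa using hy, rfl⟩, ?_⟩
    simp only [smul_eq_mul] at h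
    simp only [← mul_assoc, h, mul_inv_cancel_right]
  have hxZ : x ∉ Z := by
    intro hxZ
    have h := hdis x hxZ
    rw [disjoint_self] at h
    have h2 := hinv x Y
    rw [h] at h2
    exact hY0.ne' (h2.symm.trans hμ.1)
  have hPs : P (Z.card + 1) := by
    refine ⟨insert x Z, ?_, ?_, Finset.card_insert_of_notMem hxZ⟩
    · rw [Finset.coe_insert]
      exact Set.insert_subset hx hZX
    · rw [Finset.coe_insert]
      exact hZ.insert fun z hz _ => hdis z hz
  have := Nat.le_findGreatest (hbound _ hPs) hPs
  omega
end

section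
/- Let G be a group, K a positive integer, A ⊆ G a K-approximate subgroup, and μ a finitely additive measure on the subsets of G, invariant under left translation by every element of ⟨A⟩, with μ(A) = 1. Let 0 < t ≤ 1, set s = t/(2K) and N = ⌊1/s⌋, and let B ⊆ A satisfy μ(B) ≥ t. Then A is covered by N left translates, by elements of A, of the set X = {g ∈ A² : μ(gB ∩ B) ≥ s·t}; that is, there are g₁, …, g_N ∈ A with A ⊆ ⋃_{i=1}^N g_i·X. -/
open scoped Pointwise ENNReal

namespace CovAux

variable {G : Type*} [Group G] {μ : Set G → ℝ≥0∞}

theorem mono (hμ : IsFinAddMeasure μ) {Y Z : Set G} (h : Y ⊆ Z) : μ Y ≤ μ Z := by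
  have h1 := hμ.2 Y (Z \ Y) Set.disjoint_sdiff_right
  rw [Set.union_diff_cancel h] at h1
  rw [h1]
  exact le_self_add

theorem union_inter (hμ : IsFinAddMeasure μ) (Y Z : Set G) :
    μ (Y ∪ Z) + μ (Y ∩ Z) = μ Y + μ Z := by
  have h1 := hμ.2 Y (Z \ Y) Set.disjoint_sdiff_right
  rw [Set.union_diff_self] at h1
  have h2 := hμ.2 (Y ∩ Z) (Z \ Y)
    (Set.disjoint_sdiff_right.mono_left Set.inter_subset_left)
  have h3 : (Y ∩ Z) ∪ (Z \ Y) = Z := by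
    ext x
    simp only [Set.mem_union, Set.mem_inter_iff, Set.mem_diff]
    tauto
  rw [h3] at h2
  rw [h1, h2]
  ring

theorem union_le (hμ : IsFinAddMeasure μ) (Y Z : Set G) : μ (Y ∪ Z) ≤ μ Y + μ Z := by
  rw [← union_inter hμ]
  exact le_self_add

theorem biUnion_le (hμ : IsFinAddMeasure μ) {ι : Type*} (S : Finset ι) (f : ι → Set G)
    (c : ℝ≥0∞) (h : ∀ i ∈ S, μ (f i) ≤ c) : μ (⋃ i ∈ S, f i) ≤ S.card * c := by
  classical
  induction S using Finset.induction_on with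
  | empty => simp [hμ.1]
  | insert a S ha ih =>
    rw [Finset.set_biUnion_insert, Finset.card_insert_of_notMem ha]
    refine (union_le hμ _ _).trans ?_
    have h1 := ih (fun i hi => h i (Finset.mem_insert_of_mem hi))
    have h2 := h a (Finset.mem_insert_self _ _)
    push_cast
    rw [add_mul, one_mul, add_comm]
    exact add_le_add h1 h2

theorem bonferroni (hμ : IsFinAddMeasure μ) {ι : Type*} (S : Finset ι) (f : ι → Set G)
    (c d : ℝ≥0∞) (h : ∀ i ∈ S, d ≤ μ (f i))
    (hp : ∀ i ∈ S, ∀ j ∈ S, i ≠ j → μ (f i ∩ f j) ≤ c) :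
    S.card * d ≤ μ (⋃ i ∈ S, f i) + (S.card.choose 2 : ℕ) * c := by
  classical
  induction S using Finset.induction_on with
  | empty => simp
  | insert a S ha ih =>
    rw [Finset.set_biUnion_insert, Finset.card_insert_of_notMem ha]
    have h1 := ih (fun i hi => h i (Finset.mem_insert_of_mem hi))
      (fun i hi j hj => hp i (Finset.mem_insert_of_mem hi) j (Finset.mem_insert_of_mem hj))
    have h2 := h a (Finset.mem_insert_self _ _)
    have h3 : μ (f a ∩ ⋃ i ∈ S, f i) ≤ S.card * c := by
      rw [Set.inter_iUnion₂]
      refine biUnion_le hμ S _ c fun i hi => ?_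
      refine hp a (Finset.mem_insert_self _ _) i (Finset.mem_insert_of_mem hi) ?_
      rintro rfl
      exact ha hi
    have h4 := union_inter hμ (f a) (⋃ i ∈ S, f i)
    have h5 : (S.card + 1).choose 2 = S.card + S.card.choose 2 := by
      rw [Nat.choose_succ_succ' S.card 1, Nat.choose_one_right]
    rw [h5]
    push_cast
    calc ((S.card : ℝ≥0∞) + 1) * d = d + S.card * d := by ring
      _ ≤ μ (f a) + (μ (⋃ i ∈ S, f i) + (S.card.choose 2 : ℕ) * c) := add_le_add h2 h1
      _ = (μ (f a) + μ (⋃ i ∈ S, f i)) + (S.card.choose 2 : ℕ) * c := by ring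
      _ = (μ (f a ∪ ⋃ i ∈ S, f i) + μ (f a ∩ ⋃ i ∈ S, f i)) + (S.card.choose 2 : ℕ) * c := by
        rw [h4]
      _ ≤ (μ (f a ∪ ⋃ i ∈ S, f i) + S.card * c) + (S.card.choose 2 : ℕ) * c := by gcongr
      _ = _ := by ring

theorem mul_le (hμ : IsFinAddMeasure μ) {K : ℕ} {A : Set G} (hA : IsApproxSubgroup K A)
    (hinv : ∀ g ∈ Subgroup.closure A, ∀ Y : Set G, μ (g • Y) = μ Y)
    (hμA : μ A = 1) : μ (A * A) ≤ K := by
  classical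
  obtain ⟨-, E, hE, hAE⟩ := hA
  have hsub : A * A ⊆ ⋃ e ∈ E.filter (fun e => e ∈ Subgroup.closure A), e • A := by
    intro x hx
    obtain ⟨e, he, a, ha, rfl⟩ := Set.mem_mul.1 (hAE hx)
    obtain ⟨b, hb, c, hc, hbc⟩ := Set.mem_mul.1 hx
    have hmem : e ∈ Subgroup.closure A := by
      have : e = b * c * a⁻¹ := by rw [hbc]; group
      rw [this]
      exact mul_mem (mul_mem (Subgroup.subset_closure hb) (Subgroup.subset_closure hc))
        (inv_mem (Subgroup.subset_closure ha))
    refine Set.mem_iUnion₂.2 ⟨e, Finset.mem_filter.2 ⟨he, hmem⟩, ?_⟩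
    exact Set.mem_smul_set.2 ⟨a, ha, rfl⟩
  refine (mono hμ hsub).trans ((biUnion_le hμ _ _ 1 fun e he => ?_).trans ?_)
  · rw [hinv e (Finset.mem_filter.1 he).2, hμA]
  · rw [mul_one]
    exact_mod_cast (Finset.card_filter_le _ _).trans hE

theorem pad {A : Set G} (h1 : (1 : G) ∈ A) (S : Finset G) (hS : ∀ x ∈ S, x ∈ A) (N : ℕ)
    (hN : S.card ≤ N) : ∃ g : Fin N → G, (∀ i, g i ∈ A) ∧ ∀ x ∈ S, ∃ i, g i = x := by
  refine ⟨fun i => if h : i.1 < S.card then S.equivFin.symm ⟨i.1, h⟩ else 1, ?_, ?_⟩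
  · intro i
    by_cases h : i.1 < S.card
    · simp only [h, dite_true]
      exact hS _ (S.equivFin.symm ⟨i.1, h⟩).2
    · simpa only [h, dite_false] using h1
  · intro x hx
    refine ⟨⟨(S.equivFin ⟨x, hx⟩).1, lt_of_lt_of_le (S.equivFin ⟨x, hx⟩).2 hN⟩, ?_⟩
    simp

end CovAux

/-- If `B ⊆ A` has `μ(B) ≥ t·μ(A) = t`, then with `s = t/(2K)` and `N = ⌊1/s⌋`,
the set `A` is covered by `N` left translates, by elements of `A`, of
`X = {g ∈ A² : μ(gB ∩ B) ≥ s·t}`. -/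
theorem covering_by_translates_of_large_intersection_set {G : Type*} [Group G]
    (K : ℕ) (hK : 0 < K) (A : Set G) (hA : IsApproxSubgroup K A)
    (μ : Set G → ℝ≥0∞) (hμ : IsFinAddMeasure μ)
    (hinv : ∀ g ∈ Subgroup.closure A, ∀ Y : Set G, μ (g • Y) = μ Y)
    (hμA : μ A = 1)
    (t : ℝ) (ht0 : 0 < t) (ht1 : t ≤ 1)
    (B : Set G) (hBA : B ⊆ A) (hμB : ENNReal.ofReal t ≤ μ B)
    (s : ℝ) (hs : s = t / (2 * (K : ℝ)))
    (N : ℕ) (hN : N = ⌊1 / s⌋₊)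
    (X : Set G) (hX : X = {g ∈ A * A | ENNReal.ofReal (s * t) ≤ μ (g • B ∩ B)}) :
    ∃ g : Fin N → G, (∀ i, g i ∈ A) ∧ A ⊆ ⋃ i, g i • X := by
  classical
  have hKr : (1 : ℝ) ≤ K := by exact_mod_cast hK
  have hs0 : 0 < s := by rw [hs]; positivity
  have hs1 : s ≤ 1 := by
    rw [hs, div_le_one (by positivity)]
    linarith
  have hsK : s * (2 * K) = t := by rw [hs]; field_simp
  have h1A := hA.1.1
  by_contra hcon
  have key : ∀ n ≤ N + 1, ∃ S : Finset G, S.card = n ∧ (∀ x ∈ S, x ∈ A) ∧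
      ∀ i ∈ S, ∀ j ∈ S, i ≠ j → μ (i • B ∩ j • B) ≤ ENNReal.ofReal (s * t) := by
    intro n
    induction n with
    | zero => intro _; exact ⟨∅, by simp⟩
    | succ n ih =>
      intro hn
      obtain ⟨S, hc, hSA, hp⟩ := ih (by omega)
      obtain ⟨g, hgA, hg⟩ := CovAux.pad h1A S hSA N (by omega)
      have hnc : ¬ A ⊆ ⋃ i, g i • X := fun h => hcon ⟨g, hgA, h⟩
      obtain ⟨a, haA, ha⟩ := Set.not_subset.1 hnc
      have hax : ∀ x ∈ S, x⁻¹ * a ∉ X := by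
        intro x hx hmem
        obtain ⟨i, rfl⟩ := hg x hx
        exact ha (Set.mem_iUnion.2 ⟨i, Set.mem_smul_set_iff_inv_smul_mem.2 hmem⟩)
      have hlt : ∀ x ∈ S, μ (a • B ∩ x • B) ≤ ENNReal.ofReal (s * t) := by
        intro x hx
        have hn := hax x hx
        rw [hX] at hn
        by_contra hgt
        refine hn ⟨Set.mul_mem_mul (hA.1.2 x (hSA x hx)) haA, ?_⟩
        have e := hinv x (Subgroup.subset_closure (hSA x hx)) ((x⁻¹ * a) • B ∩ B)
        rw [Set.smul_set_inter, smul_smul, mul_inv_cancel_left] at e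
        rw [← e]
        exact (not_le.1 hgt).le
      have haS : a ∉ S := by
        intro h
        have hn := hax a h
        rw [hX] at hn
        refine hn ⟨by simpa using Set.mul_mem_mul h1A h1A, ?_⟩
        rw [inv_mul_cancel, one_smul, Set.inter_self]
        refine le_trans (ENNReal.ofReal_le_ofReal ?_) hμB
        nlinarith
      refine ⟨insert a S, by rw [Finset.card_insert_of_notMem haS, hc], ?_, ?_⟩
      · intro x hx
        rcases Finset.mem_insert.1 hx with rfl | hx
        · exact haA
        · exact hSA x hx
      · intro i hi j hj hij
        rcases Finset.mem_insert.1 hi with rfl | hi2 <;>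
          rcases Finset.mem_insert.1 hj with rfl | hj2
        · exact absurd rfl hij
        · exact hlt j hj2
        · rw [Set.inter_comm]; exact hlt i hi2
        · exact hp i hi2 j hj2 hij
  obtain ⟨S, hc, hSA, hp⟩ := key (N + 1) le_rfl
  have hb := CovAux.bonferroni hμ S (fun x => x • B) (ENNReal.ofReal (s * t)) (ENNReal.ofReal t)
    (fun x hx => by rw [hinv x (Subgroup.subset_closure (hSA x hx))]; exact hμB) hp
  have hU : μ (⋃ x ∈ S, x • B) ≤ K := by
    refine (CovAux.mono hμ ?_).trans (CovAux.mul_le hμ hA hinv hμA)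
    refine Set.iUnion₂_subset fun x hx => ?_
    rintro _ ⟨b, hbB, rfl⟩
    exact Set.mul_mem_mul (hSA x hx) (hBA hbB)
  have hb2 := hb.trans (add_le_add_left hU _)
  rw [hc] at hb2
  have hst : 0 ≤ s * t := by positivity
  rw [← ENNReal.ofReal_natCast (N + 1), ← ENNReal.ofReal_natCast K,
    ← ENNReal.ofReal_natCast ((N + 1).choose 2), ← ENNReal.ofReal_mul (by positivity),
    ← ENNReal.ofReal_mul (by positivity), ← ENNReal.ofReal_add (by positivity) (by positivity),
    ENNReal.ofReal_le_ofReal_iff (by positivity), Nat.cast_choose_two] at hb2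
  push_cast at hb2
  have hN1 : (N : ℝ) * s ≤ 1 := by
    rw [← le_div_iff₀ hs0, hN]
    exact Nat.floor_le (by positivity)
  have hN2 : 1 < ((N : ℝ) + 1) * s := by
    rw [← div_lt_iff₀ hs0, hN]
    exact Nat.lt_floor_add_one _
  have h6 : ((N : ℝ) + 1) * t * (N * s) ≤ ((N : ℝ) + 1) * t * 1 :=
    mul_le_mul_of_nonneg_left hN1 (by positivity)
  have h7 : (K : ℝ) * 1 < K * (((N : ℝ) + 1) * s) := mul_lt_mul_of_pos_left hN2 (by linarith)
  have h8 : ((N : ℝ) + 1) * t = 2 * (K * (((N : ℝ) + 1) * s)) := by rw [← hsK]; ring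
  have h9 : ((N : ℝ) + 1) * ((N : ℝ) + 1 - 1) / 2 * (s * t)
      = ((N : ℝ) + 1) * t * (N * s) / 2 := by ring
  linarith
end

section
/- (Measure-theoretic Sanders theorem.) Let G be a group, K a positive integer, A ⊆ G a K-approximate subgroup, and μ a finitely additive measure on the subsets of G, invariant under left translation by every element of ⟨A⟩, with μ(A) = 1. Then for every positive integer m there exist a positive integer L, depending only on K and m, and a symmetric subset S ⊆ A² such that A is covered by L left translates of S and S^m ⊆ A⁴. In particular S is an approximate subgroup equivalent to A. -/
open scoped Pointwise ENNReal

namespace SandersAux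

lemma mono {G : Type*} [Group G] {μ : Set G → ℝ≥0∞} (h : IsFinAddMeasure μ) {X Y : Set G}
    (hXY : X ⊆ Y) : μ X ≤ μ Y := by
  have := h.2 X (Y \ X) Set.disjoint_sdiff_right
  rw [Set.union_sdiff_cancel hXY] at this
  rw [this]; exact le_self_add

lemma inter_diff {G : Type*} [Group G] {μ : Set G → ℝ≥0∞} (h : IsFinAddMeasure μ) (X Y : Set G) :
    μ X = μ (X ∩ Y) + μ (X \ Y) := by
  rw [← h.2 _ _ (Set.disjoint_sdiff_inter.symm), Set.inter_union_sdiff]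

lemma union_inter {G : Type*} [Group G] {μ : Set G → ℝ≥0∞} (h : IsFinAddMeasure μ) (X Y : Set G) :
    μ (X ∪ Y) + μ (X ∩ Y) = μ X + μ Y := by
  have h1 := h.2 X (Y \ X) Set.disjoint_sdiff_right
  rw [Set.union_sdiff_self] at h1
  rw [h1, inter_diff h Y X, Set.inter_comm X Y, add_assoc, add_comm (μ (Y \ X))]

lemma union_le {G : Type*} [Group G] {μ : Set G → ℝ≥0∞} (h : IsFinAddMeasure μ) (X Y : Set G) :
    μ (X ∪ Y) ≤ μ X + μ Y := by
  rw [← union_inter h]; exact le_self_add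

lemma biUnion_le {G ι : Type*} [Group G] {μ : Set G → ℝ≥0∞} (h : IsFinAddMeasure μ)
    (F : Finset ι) (f : ι → Set G) (s : ℝ≥0∞) (hs : ∀ i ∈ F, μ (f i) ≤ s) :
    μ (⋃ i ∈ F, f i) ≤ F.card * s := by
  classical
  induction F using Finset.induction_on with
  | empty => simp [h.1]
  | insert a F ha ih =>
    rw [Finset.set_biUnion_insert, Finset.card_insert_of_notMem ha]
    refine (union_le h _ _).trans ?_
    have h1 := ih (fun i hi => hs i (Finset.mem_insert_of_mem hi))
    have h2 := hs a (Finset.mem_insert_self _ _)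
    push_cast
    rw [add_mul, one_mul, add_comm]
    exact add_le_add h1 h2

lemma bonferroni {G ι : Type*} [Group G] {μ : Set G → ℝ≥0∞} (h : IsFinAddMeasure μ)
    (F : Finset ι) (f : ι → Set G) (s t : ℝ≥0∞) (ht : ∀ i ∈ F, t ≤ μ (f i))
    (hs : ∀ i ∈ F, ∀ j ∈ F, i ≠ j → μ (f i ∩ f j) ≤ s) :
    F.card * t ≤ μ (⋃ i ∈ F, f i) + F.card ^ 2 * s := by
  classical
  induction F using Finset.induction_on with
  | empty => simp
  | insert a F ha ih =>
    rw [Finset.set_biUnion_insert, Finset.card_insert_of_notMem ha]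
    have h1 := ih (fun i hi => ht i (Finset.mem_insert_of_mem hi))
      (fun i hi j hj => hs i (Finset.mem_insert_of_mem hi) j (Finset.mem_insert_of_mem hj))
    have h2 := ht a (Finset.mem_insert_self _ _)
    have h3 : μ (f a ∩ ⋃ i ∈ F, f i) ≤ F.card * s := by
      rw [Set.inter_iUnion₂]
      refine biUnion_le h F (fun i => f a ∩ f i) s fun i hi => ?_
      exact hs a (Finset.mem_insert_self _ _) i (Finset.mem_insert_of_mem hi)
        (fun e => ha (e ▸ hi))
    push_cast
    calc ((F.card : ℝ≥0∞) + 1) * t = t + F.card * t := by ring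
      _ ≤ μ (f a) + (μ (⋃ i ∈ F, f i) + F.card ^ 2 * s) := add_le_add h2 h1
      _ = (μ (f a ∪ ⋃ i ∈ F, f i) + μ (f a ∩ ⋃ i ∈ F, f i)) + F.card ^ 2 * s := by
          rw [union_inter h]; ring
      _ ≤ (μ (f a ∪ ⋃ i ∈ F, f i) + F.card * s) + F.card ^ 2 * s := by gcongr
      _ = μ (f a ∪ ⋃ i ∈ F, f i) + (F.card + F.card ^ 2) * s := by ring
      _ ≤ μ (f a ∪ ⋃ i ∈ F, f i) + ((F.card + F.card ^ 2) * s + (F.card + 1) * s) := by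
          gcongr; exact le_self_add
      _ = _ := by ring

/-- The scale sequence. -/
def scale (K : ℕ) : ℕ → ℕ
  | 0 => 1
  | i + 1 => 8 * K * scale K i ^ 2

lemma scale_pos {K : ℕ} (hK : 0 < K) (i : ℕ) : 0 < scale K i := by
  induction i with
  | zero => simp [scale]
  | succ i ih => simp only [scale]; positivity

lemma scale_le_succ {K : ℕ} (hK : 0 < K) (i : ℕ) : scale K i ≤ scale K (i + 1) := by
  have := scale_pos hK i
  simp only [scale]
  nlinarith [Nat.mul_le_mul hK this]

lemma scale_mono {K : ℕ} (hK : 0 < K) : Monotone (scale K) :=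
  monotone_nat_of_le_succ (scale_le_succ hK)

/-- The doubling bound. -/
lemma measure_sq {G : Type*} [Group G] {A : Set G} {μ : Set G → ℝ≥0∞} {K : ℕ}
    (hA : IsApproxSubgroup K A) (h : IsFinAddMeasure μ)
    (hinv : ∀ g ∈ Subgroup.closure A, ∀ X : Set G, μ (g • X) = μ X) (h1 : μ A = 1) :
    μ (A * A) ≤ K := by
  classical
  obtain ⟨-, E, hE, hAE⟩ := hA
  let F := E.filter (· ∈ Subgroup.closure A)
  have hsub : A * A ⊆ ⋃ g ∈ F, g • A := by
    intro x hx
    obtain ⟨e, he, a, ha, rfl⟩ := hAE hx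
    obtain ⟨b, hb, c, hc, hbc⟩ := hx
    have : e ∈ Subgroup.closure A := by
      have : e = b * c * a⁻¹ := by rw [eq_mul_inv_iff_mul_eq]; exact hbc.symm
      rw [this]
      exact mul_mem (mul_mem (Subgroup.subset_closure hb) (Subgroup.subset_closure hc))
        (inv_mem (Subgroup.subset_closure ha))
    simp only [Set.mem_iUnion]
    exact ⟨e, Finset.mem_filter.2 ⟨he, this⟩, Set.smul_mem_smul_set ha⟩
  refine (mono h hsub).trans ((biUnion_le h F _ 1 fun g hg => ?_).trans ?_)
  · rw [hinv g (Finset.mem_filter.1 hg).2, h1]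
  · rw [mul_one]
    exact_mod_cast (Finset.card_filter_le _ _).trans hE

/-- The pigeonhole step. -/
lemma pigeon {G : Type*} [Group G] {A : Set G} {μ : Set G → ℝ≥0∞} {K J : ℕ} (r : ℝ) (hr : 0 ≤ r)
    (hK : 0 < K) (hJ : r ^ J * K < 1)
    (hA : IsApproxSubgroup K A) (h : IsFinAddMeasure μ)
    (hinv : ∀ g ∈ Subgroup.closure A, ∀ X : Set G, μ (g • X) = μ X) (h1 : μ A = 1) :
    ∃ i < J, ∃ B ⊆ A, ((scale K i : ℝ≥0∞))⁻¹ ≤ μ B ∧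
      ∀ B' ⊆ B, ((scale K (i + 1) : ℝ≥0∞))⁻¹ ≤ μ B' →
        r * (μ (B * A)).toReal ≤ (μ (B' * A)).toReal := by
  by_contra hcon
  push Not at hcon
  have hsq := measure_sq hA h hinv h1
  have hfin : μ (A * A) ≠ ⊤ := ne_top_of_le_ne_top (by simp) hsq
  have key : ∀ i ≤ J, ∃ B ⊆ A, ((scale K i : ℝ≥0∞))⁻¹ ≤ μ B ∧
      (μ (B * A)).toReal ≤ r ^ i * K := by
    intro i
    induction i with
    | zero =>
      intro _
      refine ⟨A, subset_rfl, by simp [scale, h1], ?_⟩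
      rw [pow_zero, one_mul]
      have := ENNReal.toReal_mono (by simp) hsq
      simpa using this
    | succ i ih =>
      intro hi
      obtain ⟨B, hB, hB1, hB2⟩ := ih (by omega)
      obtain ⟨B', hB', h2, h3⟩ := hcon i (by omega) B hB hB1
      refine ⟨B', hB'.trans hB, h2, h3.le.trans ?_⟩
      rw [pow_succ', mul_assoc]
      exact mul_le_mul_of_nonneg_left hB2 hr
  obtain ⟨B, hB, hB1, hB2⟩ := key J le_rfl
  have hne : B.Nonempty := by
    rw [Set.nonempty_iff_ne_empty]
    rintro rfl
    rw [h.1] at hB1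
    simp at hB1
  obtain ⟨b, hb⟩ := hne
  have : 1 ≤ μ (B * A) := by
    rw [← h1, ← hinv b (Subgroup.subset_closure (hB hb))]
    exact mono h (Set.smul_set_subset_mul hb)
  have h4 : (1 : ℝ) ≤ (μ (B * A)).toReal := by
    have := ENNReal.toReal_mono
      (ne_top_of_le_ne_top hfin (mono h (Set.mul_subset_mul_right hB))) this
    simpa using this
  linarith

end SandersAux

open SandersAux in
theorem sanders_measure (K m : ℕ) (hK : 0 < K) (hm : 0 < m) :
    ∃ L : ℕ, 0 < L ∧
      ∀ (G : Type*) [Group G] (A : Set G) (μ : Set G → ℝ≥0∞),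
        IsApproxSubgroup K A → IsFinAddMeasure μ →
        (∀ g ∈ Subgroup.closure A, ∀ X : Set G, μ (g • X) = μ X) →
        μ A = 1 →
        ∃ S : Set G, S ⊆ A * A ∧ IsSymmetric S ∧
          (∃ g : Fin L → G, A ⊆ ⋃ i, g i • S) ∧
          S ^ m ⊆ A ^ 4 ∧
          (∃ K' : ℕ, IsApproxSubgroup K' S) ∧
          (∃ Z : Finset G, S ⊆ (Z : Set G) * A) ∧
          (∃ Z : Finset G, A ⊆ (Z : Set G) * S) := by
  have hm' : (1 : ℝ) ≤ m := by exact_mod_cast hm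
  have hK' : (1 : ℝ) ≤ K := by exact_mod_cast hK
  obtain ⟨ε, hε⟩ : ∃ ε : ℝ, ε = 1 / (2 * m) := ⟨_, rfl⟩
  have hε0 : 0 < ε := by rw [hε]; positivity
  have hεm : m * ε = 1 / 2 := by rw [hε]; field_simp
  have hε1 : ε ≤ 1 / 2 := by nlinarith
  obtain ⟨J, hJ⟩ := exists_pow_lt_of_lt_one (x := 1 / (K : ℝ)) (y := 1 - ε)
    (by positivity) (by linarith)
  rw [lt_div_iff₀ (by positivity)] at hJ
  refine ⟨2 * K * scale K J, by have := scale_pos hK J; positivity, ?_⟩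
  intro G _ A μ hA h hinv h1
  classical
  obtain ⟨i, hi, B, hBA, hB, hB'⟩ := pigeon (1 - ε) (by linarith) hK hJ hA h hinv h1
  have hsq := measure_sq hA h hinv h1
  have hfin : μ (A * A) ≠ ⊤ := ne_top_of_le_ne_top (by simp) hsq
  obtain ⟨⟨hA1, hAi⟩, E, hE, hAE⟩ := hA
  have hcl : ∀ {a}, a ∈ A → a ∈ Subgroup.closure A := fun ha => Subgroup.subset_closure ha
  have hcl2 : ∀ {a}, a ∈ A * A → a ∈ Subgroup.closure A := by
    rintro _ ⟨x, hx, y, hy, rfl⟩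
    exact mul_mem (hcl hx) (hcl hy)
  obtain ⟨n, hn⟩ : ∃ n, n = scale K i := ⟨_, rfl⟩
  have hn0 : 0 < n := hn ▸ scale_pos hK i
  obtain ⟨s, hs⟩ : ∃ s : ℝ≥0∞, s = ((scale K (i + 1) : ℝ≥0∞))⁻¹ := ⟨_, rfl⟩
  rw [← hs] at hB'
  obtain ⟨S, hS⟩ : ∃ S : Set G, S = {g | g ∈ A * A ∧ s ≤ μ (g • B ∩ B)} := ⟨_, rfl⟩
  have hSA : S ⊆ A * A := by rw [hS]; exact fun g hg => hg.1
  have hsB : s ≤ μ B := by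
    refine le_trans ?_ hB
    rw [hs]
    exact ENNReal.inv_le_inv.2 (by exact_mod_cast scale_le_succ hK i)
  have hSsym : IsSymmetric S := by
    refine ⟨?_, ?_⟩
    · rw [hS]
      exact ⟨⟨1, hA1, 1, hA1, one_mul 1⟩, by simpa using hsB⟩
    · intro g hg
      have hg0 := hcl2 (hSA hg)
      rw [hS] at hg ⊢
      obtain ⟨⟨x, hx, y, hy, rfl⟩, hg2⟩ := hg
      refine ⟨⟨y⁻¹, hAi _ hy, x⁻¹, hAi _ hx, by simp⟩, ?_⟩
      rw [← hinv _ hg0, Set.smul_set_inter, smul_inv_smul, Set.inter_comm]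
      exact hg2
  -- covering
  have hcover : ∃ F : Finset G, F.card ≤ 2 * K * n ∧ A ⊆ ⋃ g ∈ F, g • S := by
    by_contra hcon
    push Not at hcon
    have key : ∀ k ≤ 2 * K * n, ∃ F : Finset G, F.card = k ∧ (F : Set G) ⊆ A ∧
        ∀ g ∈ F, ∀ g' ∈ F, g ≠ g' → μ (g • B ∩ g' • B) ≤ s := by
      intro k
      induction k with
      | zero => exact fun _ => ⟨∅, by simp⟩
      | succ k ih =>
        intro hk
        obtain ⟨F, hF, hFA, hF2⟩ := ih (by omega)
        obtain ⟨a, ha, haF⟩ := Set.not_subset.1 (hcon F (by omega))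
        have hlt : ∀ g ∈ F, μ (a • B ∩ g • B) ≤ s ∧ a ≠ g := by
          intro g hg
          have hnot : g⁻¹ * a ∉ S := by
            intro hmem
            apply haF
            simp only [Set.mem_iUnion]
            exact ⟨g, hg, Set.mem_smul_set_iff_inv_smul_mem.2 hmem⟩
          constructor
          · rw [hS] at hnot
            have : ¬ s ≤ μ ((g⁻¹ * a) • B ∩ B) := fun hh =>
              hnot ⟨⟨g⁻¹, hAi _ (hFA hg), a, ha, rfl⟩, hh⟩
            rw [← hinv _ (hcl (hFA hg)), Set.smul_set_inter, smul_smul, mul_inv_cancel_left] at this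
            exact (not_le.1 this).le
          · rintro rfl
            apply hnot
            rw [inv_mul_cancel]
            exact hSsym.1
        have haF' : a ∉ F := fun hh => (hlt a hh).2 rfl
        refine ⟨insert a F, by rw [Finset.card_insert_of_notMem haF', hF], ?_, ?_⟩
        · rw [Finset.coe_insert]
          exact Set.insert_subset ha hFA
        · intro g hg g' hg' hne
          rcases Finset.mem_insert.1 hg with rfl | hgF
          · rcases Finset.mem_insert.1 hg' with rfl | hg'
            · exact absurd rfl hne
            · exact (hlt g' hg').1
          · rcases Finset.mem_insert.1 hg' with rfl | hg'
            · rw [Set.inter_comm]; exact (hlt g hgF).1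
            · exact hF2 g hgF g' hg' hne
    obtain ⟨F, hF, hFA, hF2⟩ := key _ le_rfl
    have hb := bonferroni h F (fun g => g • B) s ((n : ℝ≥0∞))⁻¹
      (fun g hg => by rw [hinv g (hcl (hFA hg)), hn]; exact hB) hF2
    have hU : μ (⋃ g ∈ F, g • B) ≤ K := by
      refine (mono h ?_).trans hsq
      refine Set.iUnion₂_subset fun g hg => ?_
      exact (Set.smul_set_subset_mul (hFA hg)).trans (Set.mul_subset_mul_left hBA)
    have hb2 := hb.trans (add_le_add_left hU _)
    rw [hF, hs] at hb2
    have h8 : scale K (i + 1) = 8 * K * n ^ 2 := by rw [hn]; rfl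
    rw [h8] at hb2
    have hn' : (0 : ℝ) < n := by exact_mod_cast hn0
    have hb3 := ENNReal.toReal_mono (by
      refine ENNReal.add_ne_top.2 ⟨by simp, ENNReal.mul_ne_top (ENNReal.pow_ne_top (ENNReal.natCast_ne_top _)) ?_⟩
      rw [ENNReal.inv_ne_top]
      exact_mod_cast (by positivity : 8 * K * n ^ 2 ≠ 0)) hb2
    rw [ENNReal.toReal_add (by simp) (by
      refine ENNReal.mul_ne_top (ENNReal.pow_ne_top (ENNReal.natCast_ne_top _)) ?_
      rw [ENNReal.inv_ne_top]
      exact_mod_cast (by positivity : 8 * K * n ^ 2 ≠ 0))] at hb3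
    simp only [ENNReal.toReal_mul, ENNReal.toReal_inv, ENNReal.toReal_natCast,
      ENNReal.toReal_pow] at hb3
    push_cast at hb3
    have e1 : 2 * (K : ℝ) * n * (n : ℝ)⁻¹ = 2 * K := by field_simp
    have e2 : (2 * (K : ℝ) * n) ^ 2 * (8 * K * (n : ℝ) ^ 2)⁻¹ = K / 2 := by
      field_simp; norm_num
    rw [e1, e2] at hb3
    linarith
  obtain ⟨F, hF, hAF⟩ := hcover
  have hAFS : A ⊆ (F : Set G) * S := by
    intro a ha
    have := hAF ha
    simp only [Set.mem_iUnion] at this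
    obtain ⟨g, hg, hx⟩ := this
    exact Set.smul_set_subset_mul (Finset.mem_coe.2 hg) hx
  -- the power bound
  have hCfin : μ (B * A) ≠ ⊤ := ne_top_of_le_ne_top hfin (mono h (Set.mul_subset_mul_right hBA))
  have hSstep : ∀ g ∈ S, (μ (g • (B * A) \ (B * A))).toReal ≤ ε * (μ (B * A)).toReal := by
    intro g hg
    have hg0 := hcl2 (hSA hg)
    rw [hS] at hg
    have e := hB' _ Set.inter_subset_right hg.2
    have hsub : (g • B ∩ B) * A ⊆ g • (B * A) ∩ (B * A) := by
      refine Set.subset_inter ?_ (Set.mul_subset_mul_right Set.inter_subset_right)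
      rw [← smul_mul_assoc]
      exact Set.mul_subset_mul_right Set.inter_subset_left
    have hf1 : μ (g • (B * A) ∩ (B * A)) ≠ ⊤ :=
      ne_top_of_le_ne_top hCfin (mono h Set.inter_subset_right)
    have hf2 : μ (g • (B * A) \ (B * A)) ≠ ⊤ :=
      ne_top_of_le_ne_top hCfin ((mono h Set.sdiff_subset).trans (hinv _ hg0 _).le)
    have e2 := ENNReal.toReal_mono hf1 (mono h hsub)
    have e3 := inter_diff h (g • (B * A)) (B * A)
    rw [hinv _ hg0] at e3
    have e4 := congrArg ENNReal.toReal e3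
    rw [ENNReal.toReal_add hf1 hf2] at e4
    linarith
  have hpow : ∀ k : ℕ, ∀ g ∈ S ^ k, g ∈ Subgroup.closure A ∧
      (μ (g • (B * A) \ (B * A))).toReal ≤ k * ε * (μ (B * A)).toReal := by
    intro k
    induction k with
    | zero =>
      intro g hg
      rw [pow_zero, Set.mem_one] at hg
      subst hg
      simp [h.1, one_mem]
    | succ k ih =>
      intro g hg
      rw [pow_succ'] at hg
      obtain ⟨x, hx, y, hy, rfl⟩ := hg
      obtain ⟨hy1, hy2⟩ := ih y hy
      have hx0 := hcl2 (hSA hx)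
      refine ⟨mul_mem hx0 hy1, ?_⟩
      have hx2 := hSstep x hx
      have hsub : (x * y) • (B * A) \ (B * A) ⊆
          x • (y • (B * A) \ (B * A)) ∪ (x • (B * A) \ (B * A)) := by
        rw [Set.smul_set_sdiff, smul_smul]
        intro z hz
        by_cases hzx : z ∈ x • (B * A)
        · exact Or.inr ⟨hzx, hz.2⟩
        · exact Or.inl ⟨hz.1, hzx⟩
      have hf1 : μ (x • (B * A) \ (B * A)) ≠ ⊤ :=
        ne_top_of_le_ne_top hCfin ((mono h Set.sdiff_subset).trans (hinv _ hx0 _).le)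
      have hf2 : μ (y • (B * A) \ (B * A)) ≠ ⊤ :=
        ne_top_of_le_ne_top hCfin ((mono h Set.sdiff_subset).trans (hinv _ hy1 _).le)
      have e := (mono h hsub).trans (union_le h _ _)
      rw [hinv _ hx0] at e
      have e2 := ENNReal.toReal_mono (ENNReal.add_ne_top.2 ⟨hf2, hf1⟩) e
      rw [ENNReal.toReal_add hf2 hf1] at e2
      push_cast
      linarith
  have hBne : B.Nonempty := by
    rw [Set.nonempty_iff_ne_empty]
    rintro rfl
    rw [h.1] at hB
    simp at hB
  obtain ⟨b, hb⟩ := hBne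
  have hC1 : (1 : ℝ) ≤ (μ (B * A)).toReal := by
    have : 1 ≤ μ (B * A) := by
      rw [← h1, ← hinv b (hcl (hBA hb))]
      exact mono h (Set.smul_set_subset_mul hb)
    simpa using ENNReal.toReal_mono hCfin this
  have h4 : A ^ 4 = (A * A) * (A * A) := by
    rw [← pow_two, ← pow_two, ← pow_mul]
  have hSm : S ^ m ⊆ A ^ 4 := by
    intro g hg
    obtain ⟨hg1, hg2⟩ := hpow m g hg
    have hnd : ¬ Disjoint (g • (B * A)) (B * A) := by
      intro hd
      rw [hd.sdiff_eq_left, hinv _ hg1, hεm] at hg2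
      linarith
    obtain ⟨z, hz1, hz2⟩ := Set.not_disjoint_iff.1 hnd
    obtain ⟨w, ⟨b1, hb1, a1, ha1, rfl⟩, hw⟩ := hz1
    obtain ⟨b2, hb2, a2, ha2, rfl⟩ := hz2
    rw [h4]
    refine ⟨b2 * a2, ⟨b2, hBA hb2, a2, ha2, rfl⟩, a1⁻¹ * b1⁻¹,
      ⟨a1⁻¹, hAi _ ha1, b1⁻¹, hAi _ (hBA hb1), rfl⟩, ?_⟩
    simp only [smul_eq_mul] at hw
    simp only
    rw [← hw]
    group
  refine ⟨S, hSA, hSsym, ?_, hSm, ?_, ⟨E, hSA.trans hAE⟩, ⟨F, hAFS⟩⟩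
  · have hcard : F.card ≤ 2 * K * scale K J :=
      hF.trans (Nat.mul_le_mul_left _ (hn ▸ scale_mono hK hi.le))
    refine ⟨fun j => if hj : j.1 < F.card then (F.equivFin.symm ⟨j.1, hj⟩ : G) else 1, ?_⟩
    intro a ha
    have := hAF ha
    simp only [Set.mem_iUnion] at this
    obtain ⟨g, hg, hx⟩ := this
    rw [Set.mem_iUnion]
    refine ⟨⟨(F.equivFin ⟨g, hg⟩).1, lt_of_lt_of_le (F.equivFin ⟨g, hg⟩).2 hcard⟩, ?_⟩
    simpa using hx
  · refine ⟨(E * E * E * F).card, hSsym, E * E * E * F, le_rfl, ?_⟩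
    push_cast
    calc S * S ⊆ (A * A) * (A * A) := Set.mul_subset_mul hSA hSA
      _ ⊆ (E * A) * (A * A) := Set.mul_subset_mul_right hAE
      _ = E * (A * A) * A := by simp only [mul_assoc]
      _ ⊆ E * (E * A) * A := Set.mul_subset_mul_right (Set.mul_subset_mul_left hAE)
      _ = E * E * (A * A) := by simp only [mul_assoc]
      _ ⊆ E * E * (E * A) := Set.mul_subset_mul_left hAE
      _ ⊆ E * E * (E * (F * S)) := Set.mul_subset_mul_left (Set.mul_subset_mul_left hAFS)
      _ = E * E * E * F * S := by simp only [mul_assoc]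
end

section
/- Let G be a group, K a positive integer, A ⊆ G a K-approximate subgroup, and μ a finitely additive measure on the subsets of G, invariant under left translation by every element of ⟨A⟩, with μ(A) = 1. Then there is a sequence (S_i : i < ω) of symmetric subsets of G with S_0 = A such that for every i: S_{i+1} ⊆ S_i², S_{i+1}⁸ ⊆ S_i⁴, and S_i is covered by finitely many left translates of S_{i+1} (hence every S_i is wide in A); consequently H = ⋂_{i<ω} S_i⁴ is a subgroup of G contained in A⁴, and every S_i⁴ is a superset of H that is wide in A. -/
open scoped Pointwise ENNReal

namespace SandersAux

variable {G : Type*} [Group G]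

lemma fam_mono {μ : Set G → ℝ≥0∞} (hμ : IsFinAddMeasure μ) {X Y : Set G} (h : X ⊆ Y) :
    μ X ≤ μ Y := by
  have := hμ.2 X (Y \ X) Set.disjoint_sdiff_right
  rw [Set.union_diff_cancel h] at this
  rw [this]; exact le_self_add

lemma fam_inter_diff {μ : Set G → ℝ≥0∞} (hμ : IsFinAddMeasure μ) (X Y : Set G) :
    μ X = μ (X ∩ Y) + μ (X \ Y) := by
  rw [← hμ.2 _ _ (Set.disjoint_sdiff_inter.symm), Set.inter_union_diff]

lemma fam_union_inter {μ : Set G → ℝ≥0∞} (hμ : IsFinAddMeasure μ) (X Y : Set G) :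
    μ X + μ Y = μ (X ∪ Y) + μ (X ∩ Y) := by
  have h1 := hμ.2 (X \ Y) Y Set.disjoint_sdiff_left
  rw [Set.diff_union_self] at h1
  rw [h1, fam_inter_diff hμ X Y]
  ring

lemma fam_union_le {μ : Set G → ℝ≥0∞} (hμ : IsFinAddMeasure μ) (X Y : Set G) :
    μ (X ∪ Y) ≤ μ X + μ Y := by
  rw [fam_union_inter hμ]; exact le_self_add

lemma fam_biUnion_le {μ : Set G → ℝ≥0∞} (hμ : IsFinAddMeasure μ) (Z : Finset G)
    (f : G → Set G) : μ (⋃ z ∈ Z, f z) ≤ ∑ z ∈ Z, μ (f z) := by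
  classical
  induction Z using Finset.induction_on with
  | empty => simp [hμ.1]
  | insert a Z ha ih =>
    rw [Finset.set_biUnion_insert, Finset.sum_insert ha]
    exact (fam_union_le hμ _ _).trans (by gcongr)

lemma fin_mul_eq (Z : Finset G) (B : Set G) : (Z : Set G) * B = ⋃ z ∈ Z, z • B := by
  ext x
  simp only [Set.mem_mul, Set.mem_iUnion, Set.mem_smul_set, Finset.mem_coe, smul_eq_mul,
    exists_prop]

lemma fam_fin_mul_le {μ : Set G → ℝ≥0∞} (hμ : IsFinAddMeasure μ) {L : Subgroup G}
    (hinv : ∀ g ∈ L, ∀ X : Set G, μ (g • X) = μ X) (Z : Finset G) (hZ : (Z : Set G) ⊆ L)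
    (B : Set G) : μ ((Z : Set G) * B) ≤ Z.card * μ B := by
  rw [fin_mul_eq]
  refine (fam_biUnion_le hμ Z _).trans ?_
  rw [Finset.sum_congr rfl (fun z hz => hinv z (hZ hz) B)]
  simp

/-- Parameters for the packing argument. -/
lemma exists_param (M t : ℝ≥0∞) (hM : M ≠ ⊤) (ht : t ≠ 0) :
    ∃ s : ℝ≥0∞, s ≠ 0 ∧ s ≤ t ∧ ∃ n : ℕ, M + (n : ℝ≥0∞) ^ 2 * s < n * t := by
  obtain ⟨n, hn⟩ := ENNReal.exists_nat_mul_gt ht (b := M + 1) (by simp [hM])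
  have hn0 : (n : ℝ≥0∞) ^ 2 ≠ 0 := by
    intro h
    have : (n : ℝ≥0∞) = 0 := by simpa using h
    simp [this] at hn
  refine ⟨min t ((n : ℝ≥0∞) ^ 2)⁻¹, ?_, min_le_left _ _, n, ?_⟩
  · intro h
    rcases min_choice t ((n : ℝ≥0∞) ^ 2)⁻¹ with h' | h'
    · exact ht (h'.symm.trans h)
    · have := h'.symm.trans h
      rw [ENNReal.inv_eq_zero] at this
      exact (ENNReal.pow_ne_top (ENNReal.natCast_ne_top n)) this
  · refine lt_of_le_of_lt ?_ hn
    gcongr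
    calc (n : ℝ≥0∞) ^ 2 * min t ((n : ℝ≥0∞) ^ 2)⁻¹
        ≤ (n : ℝ≥0∞) ^ 2 * ((n : ℝ≥0∞) ^ 2)⁻¹ := by gcongr; exact min_le_right _ _
      _ ≤ 1 := ENNReal.mul_inv_le_one _

/-- Density-increment: a set `B` for which dense subsets have almost as large products. -/
lemma exists_good {μ : Set G → ℝ≥0∞} (hμ : IsFinAddMeasure μ) (A : Set G)
    (hinv : ∀ g ∈ Subgroup.closure A, ∀ X : Set G, μ (g • X) = μ X)
    (h0 : μ A ≠ 0) (hfin : μ (A * A) ≠ ⊤) (s : ℝ≥0∞ → ℝ≥0∞) (hs : ∀ t, t ≠ 0 → s t ≠ 0) :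
    ∃ t : ℝ≥0∞, t ≠ 0 ∧ ∃ B ⊆ A, t ≤ μ B ∧
      ∀ X ⊆ A, s t ≤ μ X → 8 * μ (B * A) ≤ 9 * μ (X * A) := by
  by_contra! hcon
  have key : ∀ k : ℕ, ∃ t : ℝ≥0∞, t ≠ 0 ∧ ∃ B ⊆ A, t ≤ μ B ∧
      9 ^ k * μ (B * A) ≤ 8 ^ k * μ (A * A) := by
    intro k
    induction k with
    | zero => exact ⟨μ A, h0, A, subset_rfl, le_rfl, by simp⟩
    | succ k ih =>
      obtain ⟨t, ht, B, hB, htB, hk⟩ := ih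
      obtain ⟨X, hX, hsX, hlt⟩ := hcon t ht B hB htB
      refine ⟨s t, hs t ht, X, hX, hsX, ?_⟩
      calc (9 : ℝ≥0∞) ^ (k + 1) * μ (X * A) = 9 ^ k * (9 * μ (X * A)) := by ring
        _ ≤ 9 ^ k * (8 * μ (B * A)) := by gcongr
        _ = 8 * (9 ^ k * μ (B * A)) := by ring
        _ ≤ 8 * (8 ^ k * μ (A * A)) := by gcongr
        _ = _ := by ring
  have key2 : ∀ k : ℕ, (9 : ℝ≥0∞) ^ k * μ A ≤ 8 ^ k * μ (A * A) := by
    intro k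
    obtain ⟨t, ht, B, hB, htB, hk⟩ := key k
    refine le_trans ?_ hk
    gcongr
    have hne : B.Nonempty := by
      by_contra h
      rw [Set.not_nonempty_iff_eq_empty] at h
      rw [h, hμ.1] at htB
      exact ht (le_antisymm htB bot_le)
    obtain ⟨b, hb⟩ := hne
    rw [← hinv b (Subgroup.subset_closure (hB hb)) A]
    exact fam_mono hμ (Set.smul_set_subset_mul hb)
  have hAfin : μ A ≠ ⊤ := by
    intro h
    have := key2 0
    simp [h] at this
    exact hfin this
  have hpos : 0 < (μ A).toReal := ENNReal.toReal_pos h0 hAfin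
  have key3 : ∀ k : ℕ, (μ A).toReal ≤ (8 / 9 : ℝ) ^ k * (μ (A * A)).toReal := by
    intro k
    have := ENNReal.toReal_mono (by finiteness) (key2 k)
    simp only [ENNReal.toReal_mul, ENNReal.toReal_pow, ENNReal.toReal_ofNat] at this
    rw [div_pow, div_mul_eq_mul_div, le_div_iff₀ (by positivity)]
    linarith
  have hlim : Filter.Tendsto (fun k : ℕ => (8 / 9 : ℝ) ^ k * (μ (A * A)).toReal) Filter.atTop
      (nhds (0 * (μ (A * A)).toReal)) :=
    (tendsto_pow_atTop_nhds_zero_of_lt_one (by norm_num) (by norm_num)).mul_const _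
  rw [zero_mul] at hlim
  have := ge_of_tendsto' hlim key3
  linarith

/-- Sanders' theorem, in the form of a single step. -/
lemma sanders_step {μ : Set G → ℝ≥0∞} (hμ : IsFinAddMeasure μ) (A : Set G)
    (hA : IsSymmetric A)
    (hinv : ∀ g ∈ Subgroup.closure A, ∀ X : Set G, μ (g • X) = μ X)
    (h0 : μ A ≠ 0) (hfin : μ (A * A) ≠ ⊤) :
    ∃ S : Set G, IsSymmetric S ∧ S ⊆ A ^ 2 ∧ S ^ 8 ⊆ A ^ 4 ∧
      ∃ Z : Finset G, A ⊆ (Z : Set G) * S := by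
  classical
  have hpar : ∀ t : ℝ≥0∞, ∃ s : ℝ≥0∞, t ≠ 0 → (s ≠ 0 ∧ s ≤ t ∧
      ∃ n : ℕ, μ (A * A) + (n : ℝ≥0∞) ^ 2 * s < n * t) := by
    intro t
    by_cases ht : t = 0
    · exact ⟨0, fun h => absurd ht h⟩
    · obtain ⟨s, hs⟩ := exists_param (μ (A * A)) t hfin ht
      exact ⟨s, fun _ => hs⟩
  choose s hs using hpar
  obtain ⟨t, ht, B, hBA, htB, hgood⟩ := exists_good hμ A hinv h0 hfin s (fun t ht => (hs t ht).1)
  obtain ⟨hs0, hst, n, hn⟩ := hs t ht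
  have hAL : A ⊆ (Subgroup.closure A : Set G) := Subgroup.subset_closure
  have hA2L : ∀ g ∈ A ^ 2, g ∈ Subgroup.closure A := by
    intro g hg
    rw [pow_two] at hg
    obtain ⟨a, ha, b, hb, rfl⟩ := hg
    exact mul_mem (hAL ha) (hAL hb)
  have hBne : B.Nonempty := by
    by_contra h
    rw [Set.not_nonempty_iff_eq_empty] at h
    rw [h, hμ.1] at htB
    exact ht (le_antisymm htB bot_le)
  set S : Set G := {g | g ∈ A ^ 2 ∧ s t ≤ μ (B ∩ g • B)} with hS
  have hSL : ∀ g ∈ S, g ∈ Subgroup.closure A := fun g hg => hA2L g hg.1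
  set C : Set G := B * A with hC
  have hC0 : μ C ≠ 0 := by
    obtain ⟨b, hb⟩ := hBne
    have : μ A ≤ μ C := by
      rw [← hinv b (hAL (hBA hb)) A]
      exact fam_mono hμ (Set.smul_set_subset_mul hb)
    intro h
    rw [h] at this
    exact h0 (le_antisymm this bot_le)
  have hCfin : μ C ≠ ⊤ := ne_top_of_le_ne_top hfin (fam_mono hμ (Set.mul_subset_mul_right hBA))
  refine ⟨S, ⟨?_, ?_⟩, fun g hg => hg.1, ?_, ?_⟩
  · refine ⟨?_, ?_⟩
    · rw [pow_two]; exact ⟨1, hA.1, 1, hA.1, by simp⟩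
    · simpa using hst.trans htB
  · rintro g ⟨hg1, hg2⟩
    refine ⟨?_, ?_⟩
    · rw [pow_two] at hg1 ⊢
      obtain ⟨a, ha, b, hb, rfl⟩ := hg1
      exact ⟨b⁻¹, hA.2 b hb, a⁻¹, hA.2 a ha, by simp⟩
    · rw [← hinv g (hA2L g hg1), Set.smul_set_inter, smul_inv_smul, Set.inter_comm]
      exact hg2
  · -- powers of `S` almost stabilise `C`
    have h1 : ∀ g ∈ S, 9 * μ (C \ g • C) ≤ μ C := by
      rintro g ⟨hg1, hg2⟩
      have h8 := hgood (B ∩ g • B) (Set.inter_subset_left.trans hBA) hg2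
      have hsub : (B ∩ g • B) * A ⊆ C ∩ g • C := by
        refine Set.subset_inter (Set.mul_subset_mul_right Set.inter_subset_left) ?_
        refine (Set.mul_subset_mul_right Set.inter_subset_right).trans ?_
        rw [hC, smul_mul_assoc]
      have h9 : 8 * μ C ≤ 9 * μ (C ∩ g • C) := h8.trans (by gcongr; exact fam_mono hμ hsub)
      have h10 := fam_inter_diff hμ C (g • C)
      have h11 : 8 * μ C + 9 * μ (C \ g • C) ≤ 8 * μ C + μ C := by
        calc 8 * μ C + 9 * μ (C \ g • C) ≤ 9 * μ (C ∩ g • C) + 9 * μ (C \ g • C) := by gcongr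
          _ = 9 * μ C := by rw [h10]; ring
          _ = 8 * μ C + μ C := by ring
      exact (ENNReal.add_le_add_iff_left (by finiteness)).1 h11
    have h2 : ∀ k : ℕ, ∀ g ∈ S ^ k, g ∈ Subgroup.closure A ∧ 9 * μ (C \ g • C) ≤ k * μ C := by
      intro k
      induction k with
      | zero =>
        intro g hg
        have : g = 1 := by simpa using hg
        subst this
        simp [hμ.1]
      | succ k ih =>
        intro g hg
        rw [pow_succ] at hg
        obtain ⟨a, ha, b, hb, rfl⟩ := hg
        obtain ⟨ha1, ha2⟩ := ih a ha
        refine ⟨mul_mem ha1 (hSL b hb), ?_⟩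
        have hsub : C \ (a * b) • C ⊆ (C \ a • C) ∪ a • (C \ b • C) := by
          rw [Set.smul_set_sdiff, smul_smul]
          intro x hx
          by_cases hxa : x ∈ a • C
          · exact Or.inr ⟨hxa, hx.2⟩
          · exact Or.inl ⟨hx.1, hxa⟩
        calc 9 * μ (C \ (a * b) • C) ≤ 9 * (μ (C \ a • C) + μ (a • (C \ b • C))) := by
              gcongr
              exact (fam_mono hμ hsub).trans (fam_union_le hμ _ _)
          _ = 9 * μ (C \ a • C) + 9 * μ (C \ b • C) := by rw [hinv a ha1]; ring
          _ ≤ k * μ C + μ C := by gcongr; exact h1 b hb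
          _ = _ := by push_cast; ring
    intro g hg
    obtain ⟨-, hg2⟩ := h2 8 g hg
    have hne : (C ∩ g • C).Nonempty := by
      by_contra h
      rw [Set.not_nonempty_iff_eq_empty, ← Set.disjoint_iff_inter_eq_empty] at h
      rw [h.sdiff_eq_left] at hg2
      have := (ENNReal.mul_le_mul_iff_left hC0 hCfin).1 hg2
      norm_num at this
    obtain ⟨x, ⟨b, hb, a, ha, rfl⟩, y, ⟨b', hb', a', ha', rfl⟩, hxy⟩ := hne
    have hg' : g = b * a * (a'⁻¹ * b'⁻¹) := by
      simp only [smul_eq_mul] at hxy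
      rw [← mul_inv_rev, ← hxy]; group
    rw [hg', show (4 : ℕ) = 2 + 2 from rfl, pow_add, pow_two]
    exact Set.mul_mem_mul (Set.mul_mem_mul (hBA hb) ha)
      (Set.mul_mem_mul (hA.2 _ ha') (hA.2 _ (hBA hb')))
  · -- packing
    by_contra! hcon
    have key : ∀ k : ℕ, ∃ Z : Finset G, (Z : Set G) ⊆ A ∧ Z.card ≤ k ∧
        k * t ≤ μ ((Z : Set G) * B) + (k : ℝ≥0∞) ^ 2 * s t := by
      intro k
      induction k with
      | zero => exact ⟨∅, by simp, by simp, by simp⟩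
      | succ k ih =>
        obtain ⟨Z, hZA, hZk, hZ⟩ := ih
        obtain ⟨a, ha, haZ⟩ := Set.not_subset.1 (hcon Z)
        refine ⟨insert a Z, ?_, (Finset.card_insert_le _ _).trans (by omega), ?_⟩
        · rw [Finset.coe_insert]; exact Set.insert_subset ha hZA
        have hpair : ∀ z ∈ Z, μ (z • B ∩ a • B) ≤ s t := by
          intro z hz
          by_contra! hlt
          apply haZ
          refine ⟨z, hz, z⁻¹ * a, ⟨?_, ?_⟩, by simp⟩
          · rw [pow_two]; exact Set.mul_mem_mul (hA.2 z (hZA hz)) ha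
          · rw [← hinv z (hAL (hZA hz)), Set.smul_set_inter, smul_smul, mul_inv_cancel_left]
            exact hlt.le
        have hint : μ ((Z : Set G) * B ∩ a • B) ≤ k * s t := by
          rw [fin_mul_eq, Set.iUnion₂_inter]
          refine (fam_biUnion_le hμ Z _).trans ((Finset.sum_le_sum hpair).trans ?_)
          rw [Finset.sum_const, nsmul_eq_mul]
          gcongr
        have hun : ((insert a Z : Finset G) : Set G) * B = (Z : Set G) * B ∪ a • B := by
          rw [fin_mul_eq, fin_mul_eq, Finset.set_biUnion_insert, Set.union_comm]
        rw [hun]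
        push_cast
        calc ((k : ℝ≥0∞) + 1) * t = k * t + t := by ring
          _ ≤ (μ ((Z : Set G) * B) + (k : ℝ≥0∞) ^ 2 * s t) + μ (a • B) := by
              rw [hinv a (hAL ha)]; gcongr
          _ = (μ ((Z : Set G) * B) + μ (a • B)) + (k : ℝ≥0∞) ^ 2 * s t := by ring
          _ = μ ((Z : Set G) * B ∪ a • B) + μ ((Z : Set G) * B ∩ a • B)
              + (k : ℝ≥0∞) ^ 2 * s t := by rw [fam_union_inter hμ]
          _ ≤ μ ((Z : Set G) * B ∪ a • B) + k * s t + (k : ℝ≥0∞) ^ 2 * s t := by gcongr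
          _ ≤ μ ((Z : Set G) * B ∪ a • B) + k * s t + (k : ℝ≥0∞) ^ 2 * s t + (k + 1) * s t :=
              le_self_add
          _ = μ ((Z : Set G) * B ∪ a • B) + ((k : ℝ≥0∞) + 1) ^ 2 * s t := by ring
    obtain ⟨Z, hZA, -, hZ⟩ := key n
    have : μ ((Z : Set G) * B) ≤ μ (A * A) := fam_mono hμ (Set.mul_subset_mul hZA hBA)
    have h3 := hZ.trans (add_le_add_left this _)
    exact absurd hn (not_lt.2 h3)

lemma restrict_cover (L : Subgroup G) {X Y : Set G} (hX : X ⊆ L) (hY : Y ⊆ L) (F : Finset G)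
    (h : X ⊆ (F : Set G) * Y) :
    ∃ F' : Finset G, (F' : Set G) ⊆ L ∧ X ⊆ (F' : Set G) * Y := by
  classical
  refine ⟨F.filter (· ∈ L), fun x hx => by simpa using (Finset.mem_filter.1 hx).2, ?_⟩
  intro x hx
  obtain ⟨f, hf, y, hy, rfl⟩ := h hx
  refine ⟨f, ?_, y, hy, rfl⟩
  have : f ∈ L := by
    have := L.mul_mem (hX hx) (L.inv_mem (hY hy))
    simpa using this
  simpa using And.intro hf this

lemma pow_subset_closure (A : Set G) (n : ℕ) : A ^ n ⊆ (Subgroup.closure A : Set G) := by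
  induction n with
  | zero => intro x hx; have : x = 1 := by simpa using hx
            subst this; exact one_mem _
  | succ n ih =>
    rw [pow_succ]
    rintro _ ⟨a, ha, b, hb, rfl⟩
    exact mul_mem (ih ha) (Subgroup.subset_closure hb)

lemma pow_finite {μ : Set G → ℝ≥0∞} (hμ : IsFinAddMeasure μ) (A : Set G) (h1 : (1 : G) ∈ A)
    (hinv : ∀ g ∈ Subgroup.closure A, ∀ X : Set G, μ (g • X) = μ X)
    (hfin : μ A ≠ ⊤) (E : Finset G) (hE : A * A ⊆ (E : Set G) * A) (n : ℕ) : μ (A ^ n) ≠ ⊤ := by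
  classical
  have hAL : A ⊆ (Subgroup.closure A : Set G) := Subgroup.subset_closure
  have hcov : ∃ F : Finset G, A ^ n ⊆ (F : Set G) * A := by
    induction n with
    | zero => exact ⟨{1}, by simpa using h1⟩
    | succ n ih =>
      obtain ⟨F, hF⟩ := ih
      refine ⟨F * E, ?_⟩
      rw [pow_succ, Finset.coe_mul, mul_assoc]
      exact (Set.mul_subset_mul_right hF).trans
        (by rw [mul_assoc]; exact Set.mul_subset_mul_left hE)
  obtain ⟨F, hF⟩ := hcov
  obtain ⟨F', hF'L, hF'⟩ := restrict_cover _ (pow_subset_closure A n) hAL F hF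
  refine ne_top_of_le_ne_top ?_ ((fam_mono hμ hF').trans (fam_fin_mul_le hμ hinv F' hF'L A))
  finiteness

end SandersAux

/-- Iterating Sanders' theorem yields a descending chain of symmetric wide sets `Sᵢ` with
`S₀ = A`, `S_{i+1} ⊆ Sᵢ²`, `S_{i+1}⁸ ⊆ Sᵢ⁴`, each `Sᵢ` covered by finitely many translates
of `S_{i+1}`; hence `H = ⋂ᵢ Sᵢ⁴` is a subgroup contained in `A⁴` and every `Sᵢ⁴ ⊇ H`
is wide in `A`. -/
theorem sanders_iterated_chain {G : Type*} [Group G]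
    (K : ℕ) (hK : 0 < K) (A : Set G) (hA : IsApproxSubgroup K A)
    (μ : Set G → ℝ≥0∞) (hμ : IsFinAddMeasure μ)
    (hinv : ∀ g ∈ Subgroup.closure A, ∀ X : Set G, μ (g • X) = μ X)
    (hμA : μ A = 1) :
    ∃ S : ℕ → Set G, S 0 = A ∧ (∀ i, IsSymmetric (S i)) ∧
      (∀ i, S (i + 1) ⊆ S i ^ 2) ∧
      (∀ i, S (i + 1) ^ 8 ⊆ S i ^ 4) ∧
      (∀ i, ∃ Z : Finset G, S i ⊆ (Z : Set G) * S (i + 1)) ∧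
      (∀ i, ∃ Z : Finset G, A ⊆ (Z : Set G) * S i) ∧
      ∃ H : Subgroup G, (H : Set G) = ⋂ i, S i ^ 4 ∧ (H : Set G) ⊆ A ^ 4 ∧
        ∀ i, (H : Set G) ⊆ S i ^ 4 ∧ ∃ Z : Finset G, A ⊆ (Z : Set G) * S i ^ 4 := by
  classical
  obtain ⟨hsym, E, -, hE⟩ := hA
  have hfinpow := SandersAux.pow_finite hμ A hsym.1 hinv (by simp [hμA]) E hE
  let P : Set G → Prop := fun S => IsSymmetric S ∧ (∃ n : ℕ, S ⊆ A ^ n) ∧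
    ∃ F : Finset G, A ⊆ (F : Set G) * S
  have hstep : ∀ S : {S : Set G // P S}, ∃ S' : {S : Set G // P S},
      S'.1 ⊆ S.1 ^ 2 ∧ S'.1 ^ 8 ⊆ S.1 ^ 4 ∧ ∃ Z : Finset G, S.1 ⊆ (Z : Set G) * S'.1 := by
    rintro ⟨S, hS, ⟨n, hn⟩, F, hF⟩
    have hSL : S ⊆ (Subgroup.closure A : Set G) :=
      hn.trans (SandersAux.pow_subset_closure A n)
    have hinvS : ∀ g ∈ Subgroup.closure S, ∀ X : Set G, μ (g • X) = μ X :=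
      fun g hg => hinv g ((Subgroup.closure_le _).2 hSL hg)
    have h0 : μ S ≠ 0 := by
      obtain ⟨F', hF'L, hF'⟩ :=
        SandersAux.restrict_cover _ Subgroup.subset_closure hSL F hF
      intro h
      have := (SandersAux.fam_mono hμ hF').trans (SandersAux.fam_fin_mul_le hμ hinv F' hF'L S)
      rw [h, hμA] at this
      simp at this
    have hSS : S * S ⊆ A ^ (n + n) := by
      rw [pow_add]; exact Set.mul_subset_mul hn hn
    have hfin : μ (S * S) ≠ ⊤ :=
      ne_top_of_le_ne_top (hfinpow (n + n)) (SandersAux.fam_mono hμ hSS)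
    obtain ⟨T, hT, hT2, hT8, Z, hZ⟩ := SandersAux.sanders_step hμ S hS hinvS h0 hfin
    refine ⟨⟨T, hT, ⟨n + n, hT2.trans (by rw [pow_two]; exact hSS)⟩, F * Z, ?_⟩, hT2, hT8, Z, hZ⟩
    rw [Finset.coe_mul, mul_assoc]
    exact hF.trans (Set.mul_subset_mul_left hZ)
  choose f hf using hstep
  let S0 : {S : Set G // P S} := ⟨A, hsym, ⟨1, by simp⟩, {1}, by simp⟩
  let S : ℕ → {S : Set G // P S} := fun n => Nat.rec S0 (fun _ T => f T) n
  have hSs : ∀ i, S (i + 1) = f (S i) := fun i => rfl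
  have h8 : ∀ i, (S (i + 1)).1 ^ 8 ⊆ (S i).1 ^ 4 := fun i => (hf (S i)).2.1
  have hone : ∀ i, (1 : G) ∈ (S i).1 ^ 4 := fun i => Set.one_mem_pow (S i).2.1.1
  have hinvpow : ∀ i, ∀ x ∈ (S i).1 ^ 4, x⁻¹ ∈ (S i).1 ^ 4 := by
    intro i x hx
    have hi : ((S i).1)⁻¹ ⊆ (S i).1 := by
      intro y hy
      simpa using (S i).2.1.2 _ (Set.mem_inv.1 hy)
    have : x⁻¹ ∈ ((S i).1 ^ 4)⁻¹ := by simpa using hx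
    rw [← inv_pow] at this
    exact Set.pow_subset_pow_left hi this
  let H : Subgroup G :=
    { carrier := ⋂ i, (S i).1 ^ 4
      one_mem' := Set.mem_iInter.2 hone
      mul_mem' := by
        intro x y hx hy
        rw [Set.mem_iInter] at hx hy ⊢
        intro i
        apply h8 i
        rw [show (8 : ℕ) = 4 + 4 from rfl, pow_add]
        exact Set.mul_mem_mul (hx (i + 1)) (hy (i + 1))
      inv_mem' := by
        intro x hx
        rw [Set.mem_iInter] at hx ⊢
        exact fun i => hinvpow i x (hx i) }
  have hHi : ∀ i, (H : Set G) ⊆ (S i).1 ^ 4 := fun i => Set.iInter_subset _ i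
  refine ⟨fun i => (S i).1, rfl, fun i => (S i).2.1, fun i => (hf (S i)).1, h8,
    fun i => (hf (S i)).2.2, fun i => (S i).2.2.2, H, rfl, hHi 0, fun i => ⟨hHi i, ?_⟩⟩
  obtain ⟨F, hF⟩ := (S i).2.2.2
  refine ⟨F, hF.trans (Set.mul_subset_mul_left ?_)⟩
  have := Set.pow_subset_pow_right (S i).2.1.1 (show 1 ≤ 4 by norm_num)
  simpa using this
end

section
/- (Normal version of Sanders' theorem.) Let G be a group, K and N positive integers, A ⊆ G a K-approximate subgroup, and μ a finitely additive measure on the subsets of G, invariant under left translation by every element of ⟨A⟩, with μ(A) = 1. Let R ⊆ G be symmetric with R⁴ ⊆ A⁴, and suppose A is covered by N left translates of R. Then there exist a positive integer L, depending only on K and N, and a symmetric subset S ⊆ A¹², such that A is covered by L left translates of S and a·S⁸·a⁻¹ ⊆ R⁴ for every a ∈ A. -/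
open scoped Pointwise ENNReal

section Helpers

variable {G : Type*} [Group G]

theorem fam_mono {μ : Set G → ℝ≥0∞} (h : IsFinAddMeasure μ) {X Y : Set G} (hXY : X ⊆ Y) :
    μ X ≤ μ Y := by
  have h1 := h.2 X (Y \ X) Set.disjoint_sdiff_right
  rw [Set.union_sdiff_cancel hXY] at h1
  rw [h1]; exact le_self_add

theorem fam_union {μ : Set G → ℝ≥0∞} (h : IsFinAddMeasure μ) (X Y : Set G) :
    μ (X ∪ Y) ≤ μ X + μ Y := by
  have h1 := h.2 X (Y \ X) Set.disjoint_sdiff_right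
  rw [Set.union_sdiff_self] at h1
  rw [h1]
  gcongr
  exact fam_mono h Set.sdiff_subset

theorem fam_cover {μ : Set G → ℝ≥0∞} (h : IsFinAddMeasure μ) (H : Subgroup G)
    (hinv : ∀ g ∈ H, ∀ X : Set G, μ (g • X) = μ X) {X Y : Set G} (hX : X ⊆ H) (hY : Y ⊆ H)
    (F : Finset G) (hF : X ⊆ (F : Set G) * Y) : μ X ≤ F.card * μ Y := by
  classical
  induction F using Finset.induction_on generalizing X with
  | empty =>
    have : X = ∅ := by simpa using hF
    simp [this, h.1]
  | insert a F ha ih =>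
    have h1 : μ (X \ a • Y) ≤ F.card * μ Y := by
      apply ih (Set.sdiff_subset.trans hX)
      rintro x ⟨hx, hxa⟩
      obtain ⟨f, hf, y, hy, rfl⟩ := hF hx
      rcases Finset.mem_insert.1 (by exact_mod_cast hf) with rfl | hf
      · exact absurd (Set.smul_mem_smul_set hy) hxa
      · exact Set.mul_mem_mul (by exact_mod_cast hf) hy
    have h2 : μ (X ∩ a • Y) ≤ μ Y := by
      by_cases haH : a ∈ H
      · rw [← hinv a haH Y]; exact fam_mono h Set.inter_subset_right
      · have : X ∩ a • Y = ∅ := by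
          ext x
          simp only [Set.mem_inter_iff, Set.mem_empty_iff_false, iff_false, not_and]
          rintro hx ⟨y, hy, rfl⟩
          apply haH
          have := H.mul_mem (hX hx) (H.inv_mem (hY hy))
          simpa using this
        rw [this, h.1]; exact zero_le
    calc μ X = μ ((X \ a • Y) ∪ (X ∩ a • Y)) := by rw [Set.sdiff_union_inter]
      _ ≤ F.card * μ Y + μ Y := (fam_union h _ _).trans (add_le_add h1 h2)
      _ = _ := by rw [Finset.card_insert_of_notMem ha]; push_cast; ring

theorem pow_cover {K : ℕ} {A : Set G} (hA : IsApproxSubgroup K A) (n : ℕ) :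
    ∃ E : Finset G, E.card ≤ K ^ n ∧ A ^ (n + 1) ⊆ (E : Set G) * A := by
  classical
  obtain ⟨-, E, hE, hAE⟩ := hA
  induction n with
  | zero => exact ⟨{1}, by simp, by simp⟩
  | succ n ih =>
    obtain ⟨E', hE', h⟩ := ih
    refine ⟨E' * E, ?_, ?_⟩
    · calc (E' * E).card ≤ E'.card * E.card := Finset.card_mul_le
        _ ≤ K ^ n * K := Nat.mul_le_mul hE' hE
        _ = _ := by ring
    · calc A ^ (n + 1 + 1) = A ^ (n + 1) * A := pow_succ _ _
        _ ⊆ E' * A * A := Set.mul_subset_mul_right h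
        _ = E' * (A * A) := mul_assoc _ _ _
        _ ⊆ E' * (E * A) := Set.mul_subset_mul_left hAE
        _ = _ := by push_cast; rw [mul_assoc]

/-- Disjoint-translates covering argument. -/
theorem cover_lemma {μ : Set G → ℝ≥0∞} (h : IsFinAddMeasure μ) (H : Subgroup G)
    (hinv : ∀ g ∈ H, ∀ X : Set G, μ (g • X) = μ X) {A B Ω S : Set G} (hA : A ⊆ H)
    (hΩ : A * B ⊆ Ω) (n M : ℕ) (t s : ℝ) (hM : μ Ω ≤ M) (ht : t ≤ (μ B).toReal)
    (hBf : μ B ≠ ∞) (hnM : (M : ℝ) < n * (t / 2)) (hs : n * s ≤ t / 2) (hs0 : 0 ≤ s)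
    (hS : ∀ g ∈ H, s ≤ (μ (g • B ∩ B)).toReal → g ∈ S) :
    ∃ F : Finset G, (F : Set G) ⊆ A ∧ F.card ≤ n ∧ A ⊆ (F : Set G) * S := by
  classical
  by_contra hcon
  have key : ∀ k : ℕ, k ≤ n → ∃ F : Finset G, (F : Set G) ⊆ A ∧ F.card = k ∧
      k * (t / 2) ≤ (μ ((F : Set G) * B)).toReal := by
    intro k
    induction k with
    | zero => intro _; exact ⟨∅, by simp, rfl, by simp⟩
    | succ k ih =>
      intro hk
      obtain ⟨F, hFA, hFc, hF⟩ := ih (by omega)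
      have hnc : ¬ A ⊆ (F : Set G) * S := fun hc => hcon ⟨F, hFA, by omega, hc⟩
      obtain ⟨a, haA, ha⟩ := Set.not_subset.1 hnc
      have hsm : ∀ g ∈ F, (μ (a • B ∩ g • B)).toReal ≤ s := by
        intro g hg
        by_contra hlt
        push Not at hlt
        apply ha
        refine ⟨g, by exact_mod_cast hg, g⁻¹ * a, ?_, by simp⟩
        have hgH : g ∈ H := hA (hFA (by exact_mod_cast hg))
        apply hS _ (H.mul_mem (H.inv_mem hgH) (hA haA))
        rw [← hinv g hgH, Set.smul_set_inter, smul_smul]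
        simpa using hlt.le
      have haB : μ (a • B) = μ B := hinv a (hA haA) B
      have hfin : ∀ X : Set G, X ⊆ Ω → μ X ≠ ∞ := fun X hX =>
        ne_top_of_le_ne_top (by simp) ((fam_mono h hX).trans hM)
      have haBΩ : a • B ⊆ Ω := by
        rintro _ ⟨b, hb, rfl⟩
        exact hΩ (Set.mul_mem_mul haA hb)
      have hFΩ : ((F : Set G) * B) ⊆ Ω := (Set.mul_subset_mul_right hFA).trans hΩ
      have hinter : ∀ F' : Finset G, F' ⊆ F →
          (μ (a • B ∩ ((F' : Set G) * B))).toReal ≤ F'.card * s := by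
        intro F'
        induction F' using Finset.induction_on with
        | empty => intro _; simp [h.1]
        | insert g F' hg ih =>
          intro hsub
          have h1 := ih ((Finset.subset_insert _ _).trans hsub)
          have h2 := hsm g (hsub (Finset.mem_insert_self _ _))
          have heq : a • B ∩ (((insert g F' : Finset G) : Set G) * B) =
              (a • B ∩ g • B) ∪ (a • B ∩ ((F' : Set G) * B)) := by
            rw [Finset.coe_insert, Set.insert_eq, Set.union_mul, Set.inter_union_distrib_left]
            congr 2
            rw [Set.singleton_mul]; rfl
          have hf1 := hfin (a • B ∩ g • B) (Set.inter_subset_left.trans haBΩ)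
          have hf2 := hfin (a • B ∩ ((F' : Set G) * B)) (Set.inter_subset_left.trans haBΩ)
          rw [heq, Finset.card_insert_of_notMem hg]
          have := ENNReal.toReal_mono (ENNReal.add_ne_top.2 ⟨hf1, hf2⟩) (fam_union h (a • B ∩ g • B) (a • B ∩ ((F' : Set G) * B)))
          rw [ENNReal.toReal_add hf1 hf2] at this
          push_cast
          linarith
      have haF : a ∉ F := by
        intro haF
        have := hsm a haF
        have h0 : (μ (a • B ∩ a • B)).toReal = (μ B).toReal := by rw [Set.inter_self, haB]
        apply ha
        refine ⟨a, by exact_mod_cast haF, 1, ?_, by simp⟩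
        apply hS _ H.one_mem
        rw [one_smul, Set.inter_self]
        have hn : (1 : ℝ) ≤ n := by exact_mod_cast (by omega : 1 ≤ n)
        nlinarith
      refine ⟨insert a F, ?_, ?_, ?_⟩
      · rw [Finset.coe_insert]; exact Set.insert_subset haA hFA
      · rw [Finset.card_insert_of_notMem haF, hFc]
      · have heq : (((insert a F : Finset G) : Set G) * B) =
            ((F : Set G) * B) ∪ (a • B \ ((F : Set G) * B)) := by
          rw [Set.union_sdiff_self, Finset.coe_insert, Set.insert_eq, Set.union_mul, Set.union_comm]
          congr 1
          rw [Set.singleton_mul]; rfl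
        have hf3 := hfin (a • B \ ((F : Set G) * B)) (Set.sdiff_subset.trans haBΩ)
        have hf4 := hfin (a • B ∩ ((F : Set G) * B)) (Set.inter_subset_left.trans haBΩ)
        have h5 := h.2 (a • B ∩ ((F : Set G) * B)) (a • B \ ((F : Set G) * B))
          (Set.disjoint_left.2 fun x hx hx' => hx'.2 hx.2)
        rw [Set.inter_union_sdiff, haB] at h5
        have h6 := congrArg ENNReal.toReal h5
        rw [ENNReal.toReal_add hf4 hf3] at h6
        rw [heq, h.2 _ _ Set.disjoint_sdiff_right, ENNReal.toReal_add (hfin _ hFΩ) hf3]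
        have h7 := hinter F subset_rfl
        rw [hFc] at h7
        have : (k : ℝ) * s ≤ n * s := by
          apply mul_le_mul_of_nonneg_right _ hs0
          exact_mod_cast (by omega : k ≤ n)
        push_cast
        linarith
  obtain ⟨F, hFA, -, hF⟩ := key n le_rfl
  have h1 : (μ ((F : Set G) * B)).toReal ≤ M := by
    have := ENNReal.toReal_mono (by simp)
      ((fam_mono h ((Set.mul_subset_mul_right hFA).trans hΩ)).trans hM)
    simpa using this
  linarith

/-- Almost-stabiliser argument. -/
theorem stab_lemma {μ : Set G → ℝ≥0∞} (h : IsFinAddMeasure μ) (H : Subgroup G)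
    (hinv : ∀ g ∈ H, ∀ X : Set G, μ (g • X) = μ X) {X S : Set G} (hX : μ X ≠ ∞)
    (hX0 : 0 < (μ X).toReal) (hSH : S ⊆ H)
    (hS : ∀ g ∈ S, 19 / 20 * (μ X).toReal ≤ (μ (g • X ∩ X)).toReal) :
    S ^ 18 ⊆ X * X⁻¹ := by
  have hfin : ∀ Y : Set G, Y ⊆ X → μ Y ≠ ∞ := fun Y hY =>
    ne_top_of_le_ne_top hX (fam_mono h hY)
  have hsplit : ∀ g : G, (μ X).toReal = (μ (g • X ∩ X)).toReal + (μ (X \ g • X)).toReal := by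
    intro g
    have h5 := h.2 (g • X ∩ X) (X \ g • X)
          (Set.disjoint_left.2 fun x hx hx' => hx'.2 hx.1)
    rw [Set.inter_comm, Set.inter_union_sdiff] at h5
    rw [h5, Set.inter_comm, ENNReal.toReal_add (hfin _ Set.inter_subset_right) (hfin _ Set.sdiff_subset)]
  have key : ∀ k : ℕ, ∀ g ∈ S ^ k, g ∈ H ∧ (μ (X \ g • X)).toReal ≤ k * (1 / 20 * (μ X).toReal) := by
    intro k
    induction k with
    | zero =>
      intro g hg
      have : g = 1 := by simpa using hg
      subst this
      simp [h.1, H.one_mem]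
    | succ k ih =>
      intro g hg
      rw [pow_succ] at hg
      obtain ⟨a, ha, b, hb, rfl⟩ := hg
      obtain ⟨haH, ha⟩ := ih a ha
      refine ⟨H.mul_mem haH (hSH hb), ?_⟩
      have hb1 := hS b hb
      have hb2 := hsplit b
      have hsub : X \ (a * b) • X ⊆ (X \ a • X) ∪ a • (X \ b • X) := by
        rw [Set.smul_set_sdiff, smul_smul]
        rintro x ⟨hx, hx'⟩
        by_cases hxa : x ∈ a • X
        · exact Or.inr ⟨hxa, hx'⟩
        · exact Or.inl ⟨hx, hxa⟩
      have h1 := (fam_mono h hsub).trans (fam_union h _ _)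
      rw [hinv a haH] at h1
      have hf1 := hfin (X \ a • X) Set.sdiff_subset
      have hf2 := hfin (X \ b • X) Set.sdiff_subset
      have h2 := ENNReal.toReal_mono (ENNReal.add_ne_top.2 ⟨hf1, hf2⟩) h1
      rw [ENNReal.toReal_add hf1 hf2] at h2
      show (μ (X \ (a * b) • X)).toReal ≤ _
      push_cast
      linarith
  intro g hg
  obtain ⟨-, hg⟩ := key 18 g hg
  have h1 := hsplit g
  have hne : (g • X ∩ X).Nonempty := by
    by_contra hne
    rw [Set.not_nonempty_iff_eq_empty] at hne
    rw [hne, h.1] at h1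
    push_cast at hg
    simp at h1
    linarith
  obtain ⟨_, ⟨x, hx, rfl⟩, hy⟩ := hne
  exact ⟨g * x, hy, x⁻¹, by simpa using hx, by simp⟩

end Helpers

theorem sanders_iter (M N : ℕ) (hM : 0 < M) (hN : 0 < N) (J : ℕ) : ∀ q : ℕ, 0 < q →
    ∃ L : ℕ, ∀ (G : Type*) [Group G] (A R B : Set G) (μ : Set G → ℝ≥0∞) (H : Subgroup G),
      IsFinAddMeasure μ → (∀ g ∈ H, ∀ X : Set G, μ (g • X) = μ X) →
      A ⊆ H → R ⊆ H → IsSymmetric R → μ (A * R) ≤ M → μ (R * R) ≤ M →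
      1 / (N : ℝ) ≤ (μ R).toReal → B ⊆ R → 1 / (q : ℝ) ≤ (μ B).toReal →
      (μ (B * R)).toReal ≤ (20 / 19) ^ J * (1 / (2 * N)) →
      ∃ S : Set G, IsSymmetric S ∧ S ^ 18 ⊆ R ^ 4 ∧ 
        ∃ F : Finset G, (F : Set G) ⊆ A ∧ F.card ≤ L ∧ A ⊆ (F : Set G) * S := by
  have hN' : (0 : ℝ) < N := by exact_mod_cast hN
  have hM' : (0 : ℝ) < M := by exact_mod_cast hM
  have basic : ∀ (q : ℕ) (hq : 0 < q) (G : Type _) [Group G] (R B : Set G) (μ : Set G → ℝ≥0∞) (H : Subgroup G),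
      IsFinAddMeasure μ → (∀ g ∈ H, ∀ X : Set G, μ (g • X) = μ X) →
      R ⊆ H → μ (R * R) ≤ M →
      1 / (N : ℝ) ≤ (μ R).toReal → B ⊆ R → 1 / (q : ℝ) ≤ (μ B).toReal →
      μ (B * R) ≠ ∞ ∧ 1 / (N : ℝ) ≤ (μ (B * R)).toReal := by
    intro q hq G _ R B μ H hμ hinv hRH hRR hR hBR hB
    have hfin : μ (B * R) ≠ ∞ := ne_top_of_le_ne_top (by simp)
      ((fam_mono hμ (Set.mul_subset_mul_right hBR)).trans hRR)
    refine ⟨hfin, ?_⟩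
    have hne : B.Nonempty := by
      by_contra hne
      rw [Set.not_nonempty_iff_eq_empty] at hne
      rw [hne, hμ.1] at hB
      have : (0 : ℝ) < 1 / q := by positivity
      simp at hB this
      linarith
    obtain ⟨b, hb⟩ := hne
    refine hR.trans (ENNReal.toReal_mono hfin ?_)
    rw [← hinv b (hRH (hBR hb)) R]
    apply fam_mono hμ
    rintro _ ⟨r, hr, rfl⟩
    exact Set.mul_mem_mul hb hr
  induction J with
  | zero =>
    intro q hq
    refine ⟨0, ?_⟩
    intro G _ A R B μ H hμ hinv hAH hRH hRs hAR hRR hR hBR hB hsmall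
    have h1 := (basic q hq G R B μ H hμ hinv hRH hRR hR hBR hB).2
    exfalso
    have h2 : (1 : ℝ) / (2 * N) < 1 / N := by
      apply one_div_lt_one_div_of_lt hN'; linarith
    simp only [pow_zero, one_mul] at hsmall
    linarith
  | succ J ih =>
    intro q hq
    set n := 2 * M * q + 1 with hn
    obtain ⟨L', hL'⟩ := ih (2 * n * q) (by positivity)
    refine ⟨max n L', ?_⟩
    intro G _ A R B μ H hμ hinv hAH hRH hRs hAR hRR hR hBR hB hsmall
    obtain ⟨hBRf, hBR0⟩ := basic q hq G R B μ H hμ hinv hRH hRR hR hBR hB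
    have hq' : (0 : ℝ) < q := by exact_mod_cast hq
    have hn' : (0 : ℝ) < n := by exact_mod_cast (by omega : 0 < n)
    by_cases hgood : ∀ B' ⊆ R, 1 / ((2 * n * q : ℕ) : ℝ) ≤ (μ B').toReal →
        19 / 20 * (μ (B * R)).toReal ≤ (μ (B' * R)).toReal
    · have hBf : μ B ≠ ∞ := by
        apply ne_top_of_le_ne_top hBRf (fam_mono hμ _)
        intro b hb
        exact ⟨b, hb, 1, hRs.1, by simp⟩
      set s : ℝ := 1 / ((2 * n * q : ℕ) : ℝ) with hs
      have hs0 : 0 ≤ s := by positivity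
      have hns : n * s = 1 / q / 2 := by
        rw [hs]; push_cast; field_simp
      refine ⟨{g | g ∈ H ∧ s ≤ (μ (g • B ∩ B)).toReal}, ⟨?_, ?_⟩, ?_, ?_⟩
      · refine ⟨H.one_mem, ?_⟩
        rw [one_smul, Set.inter_self]
        refine le_trans ?_ hB
        have : (1 : ℝ) ≤ n := by exact_mod_cast (by omega : 1 ≤ n)
        have h3 : (0 : ℝ) < 1 / q := by positivity
        nlinarith
      · rintro g ⟨hg, hgs⟩
        refine ⟨H.inv_mem hg, ?_⟩
        rw [← hinv g hg, Set.smul_set_inter, smul_smul]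
        simpa [Set.inter_comm] using hgs
      · have h1 : {g | g ∈ H ∧ s ≤ (μ (g • B ∩ B)).toReal} ^ 18 ⊆ (B * R) * (B * R)⁻¹ := by
          apply stab_lemma hμ H hinv hBRf
          · have : (0 : ℝ) < 1 / N := by positivity
            linarith
          · exact fun g hg => hg.1
          · rintro g ⟨hg, hgs⟩
            refine (hgood (g • B ∩ B) (Set.inter_subset_right.trans hBR) hgs).trans ?_
            apply ENNReal.toReal_mono
            · exact ne_top_of_le_ne_top hBRf (fam_mono hμ Set.inter_subset_right)
            · apply fam_mono hμ
              rintro _ ⟨x, ⟨⟨b, hb, rfl⟩, hx⟩, r, hr, rfl⟩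
              exact ⟨⟨b * r, Set.mul_mem_mul hb hr, by simp [mul_assoc]⟩, Set.mul_mem_mul hx hr⟩
        have hRinv : R⁻¹ ⊆ R := fun x hx => by simpa using hRs.2 _ hx
        refine h1.trans ?_
        calc (B * R) * (B * R)⁻¹ ⊆ (R * R) * (R * R)⁻¹ :=
              Set.mul_subset_mul (Set.mul_subset_mul_right hBR)
                (Set.inv_subset_inv.2 (Set.mul_subset_mul_right hBR))
          _ = (R * R) * (R⁻¹ * R⁻¹) := by rw [mul_inv_rev]
          _ ⊆ (R * R) * (R * R) := Set.mul_subset_mul_left (Set.mul_subset_mul hRinv hRinv)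
          _ = R ^ 4 := by simp only [pow_succ, pow_zero, one_mul, mul_assoc]
      · obtain ⟨F, hF1, hF2, hF3⟩ := cover_lemma (S := {g | g ∈ H ∧ s ≤ (μ (g • B ∩ B)).toReal})
          hμ H hinv hAH (Set.mul_subset_mul_left hBR) n M (1 / q) s hAR hB hBf
          (by
            have : (n : ℝ) = 2 * M * q + 1 := by rw [hn]; push_cast; ring
            rw [this]
            have h3 : (0 : ℝ) < 1 / q / 2 := by positivity
            have h4 : (2 * M * q : ℝ) * (1 / q / 2) = M := by field_simp
            linarith) hns.le hs0 (fun g hg hgs => ⟨hg, hgs⟩)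
        exact ⟨F, hF1, hF2.trans (le_max_left _ _), hF3⟩
    · push Not at hgood
      obtain ⟨B', hB'R, hB', hlt⟩ := hgood
      obtain ⟨S, h1, h2, F, h3, h4, h5⟩ := hL' G A R B' μ H hμ hinv hAH hRH hRs hAR hRR hR hB'R hB' (by
        have : (20 / 19 : ℝ) ^ (J + 1) * (1 / (2 * N)) = 20 / 19 * ((20 / 19 : ℝ) ^ J * (1 / (2 * N))) := by
          ring
        rw [this] at hsmall
        linarith)
      exact ⟨S, h1, h2, F, h3, h4.trans (le_max_right _ _), h5⟩

theorem symm_pow_mono {G : Type*} [Group G] {A : Set G} (hA : IsSymmetric A) {m n : ℕ} (h : m ≤ n) :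
    A ^ m ⊆ A ^ n := Set.pow_subset_pow_right hA.1 h

theorem sanders_base (K N : ℕ) (hK : 0 < K) (hN : 0 < N) :
    ∃ L : ℕ, ∀ (G : Type*) [Group G] (A R : Set G) (μ : Set G → ℝ≥0∞),
        IsApproxSubgroup K A → IsFinAddMeasure μ →
        (∀ g ∈ Subgroup.closure A, ∀ X : Set G, μ (g • X) = μ X) →
        μ A = 1 →
        IsSymmetric R → R ^ 4 ⊆ A ^ 4 →
        (∃ c : Fin N → G, A ⊆ ⋃ i, c i • R) →
        ∃ S : Set G, IsSymmetric S ∧ S ^ 18 ⊆ R ^ 4 ∧ 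
        ∃ F : Finset G, (F : Set G) ⊆ A ∧ F.card ≤ L ∧ A ⊆ (F : Set G) * S := by
  classical
  have hN' : (0 : ℝ) < N := by exact_mod_cast hN
  obtain ⟨J, hJ⟩ := pow_unbounded_of_one_lt ((K ^ 4 : ℕ) * (2 * N) : ℝ) (by norm_num : (1 : ℝ) < 20 / 19)
  obtain ⟨L, hL⟩ := sanders_iter (K ^ 4) N (by positivity) hN J N hN
  refine ⟨L, ?_⟩
  rintro G _ A R μ hA hμ hinv hμA hR hRA ⟨c, hc⟩
  set H := Subgroup.closure A with hH
  have hAH : A ⊆ H := Subgroup.subset_closure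
  have hpowH : ∀ n, A ^ n ⊆ H := by
    intro n
    induction n with
    | zero => simp [H.one_mem]
    | succ n ih =>
      rw [pow_succ]
      rintro _ ⟨x, hx, y, hy, rfl⟩
      exact H.mul_mem (ih hx) (hAH hy)
  have hRA4 : R ⊆ A ^ 4 := by
    refine Set.Subset.trans ?_ hRA
    simpa using symm_pow_mono hR (by norm_num : 1 ≤ 4)
  have hRRA : R * R ⊆ A ^ 4 := by
    refine Set.Subset.trans ?_ hRA
    rw [← pow_two]
    exact symm_pow_mono hR (by norm_num)
  have hRH : R ⊆ H := hRA4.trans (hpowH 4)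
  have hA5 : μ (A ^ 5) ≤ (K ^ 4 : ℕ) := by
    obtain ⟨E, hE, hE'⟩ := pow_cover hA 4
    have := fam_cover hμ H hinv (hpowH 5) hAH E hE'
    rw [hμA, mul_one] at this
    exact this.trans (by exact_mod_cast hE)
  have hRR : μ (R * R) ≤ (K ^ 4 : ℕ) :=
    (fam_mono hμ (hRRA.trans (symm_pow_mono hA.1 (by norm_num)))).trans hA5
  have hAR : μ (A * R) ≤ (K ^ 4 : ℕ) := by
    refine (fam_mono hμ ?_).trans hA5
    rw [pow_succ' A 4]
    exact Set.mul_subset_mul_left hRA4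
  have hμR : 1 / (N : ℝ) ≤ (μ R).toReal := by
    have h1 := fam_cover hμ H hinv hAH hRH (Finset.univ.image c) (by
      intro a ha
      obtain ⟨i, r, hr, rfl⟩ := Set.mem_iUnion.1 (hc ha)
      exact ⟨c i, by simp, r, hr, rfl⟩)
    have h2 : ((Finset.univ.image c).card : ℝ≥0∞) ≤ N := by
      exact_mod_cast (Finset.card_image_le).trans (by simp)
    have h3 : 1 ≤ (N : ℝ≥0∞) * μ R := by
      rw [← hμA]; exact h1.trans (by gcongr)
    have hRf : μ R ≠ ∞ := ne_top_of_le_ne_top (by simp)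
      ((fam_mono hμ (hRA4.trans (symm_pow_mono hA.1 (by norm_num)))).trans hA5)
    have h4 := ENNReal.toReal_mono (ENNReal.mul_ne_top (by simp) hRf) h3
    rw [ENNReal.toReal_mul] at h4
    simp at h4
    rw [div_le_iff₀ hN']
    linarith
  refine hL G A R R μ H hμ hinv hAH hRH hR hAR hRR hμR subset_rfl hμR ?_
  have h1 : (μ (R * R)).toReal ≤ (K ^ 4 : ℕ) := by
    simpa using ENNReal.toReal_mono (by simp) hRR
  refine h1.trans ?_
  rw [mul_one_div, le_div_iff₀ (by positivity)]
  exact hJ.le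

theorem pow_conj {G : Type*} [Group G] {S T : Set G} (h : G) 
    (hST : ∀ x ∈ S, h * x * h⁻¹ ∈ T) (n : ℕ) : ∀ x ∈ S ^ n, h * x * h⁻¹ ∈ T ^ n := by
  induction n with
  | zero => intro x hx; simp at hx ⊢; simp [hx]
  | succ n ih =>
    rintro _ hx
    rw [pow_succ] at hx ⊢
    obtain ⟨x, hx, y, hy, rfl⟩ := hx
    refine ⟨_, ih x hx, _, hST y hy, ?_⟩
    simp [mul_assoc]

/-- Normal version of Sanders' theorem: for all `K, N` there is `L`, depending only on `K`
and `N`, such that whenever `A` is a definably amenable `K`-approximate subgroup and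
`R` is a symmetric `N`-wide subset with `R⁴ ⊆ A⁴`, there is a symmetric `L`-wide
`S ⊆ A¹²` with `a·S⁸·a⁻¹ ⊆ R⁴` for all `a ∈ A`. -/
theorem sanders_normal (K N : ℕ) (hK : 0 < K) (hN : 0 < N) :
    ∃ L : ℕ, 0 < L ∧
      ∀ (G : Type*) [Group G] (A R : Set G) (μ : Set G → ℝ≥0∞),
        IsApproxSubgroup K A → IsFinAddMeasure μ →
        (∀ g ∈ Subgroup.closure A, ∀ X : Set G, μ (g • X) = μ X) →
        μ A = 1 →
        IsSymmetric R → R ^ 4 ⊆ A ^ 4 →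
        (∃ c : Fin N → G, A ⊆ ⋃ i, c i • R) →
        ∃ S : Set G, S ⊆ A ^ 12 ∧ IsSymmetric S ∧
          (∃ g : Fin L → G, A ⊆ ⋃ i, g i • S) ∧
          ∀ a ∈ A, ∀ x ∈ S ^ 8, a * x * a⁻¹ ∈ R ^ 4 := by
  classical
  obtain ⟨L, hL⟩ := sanders_base K N hK hN
  refine ⟨(K * L + 1) ^ L, by positivity, ?_⟩
  intro G _ A R μ hA hμ hinv hμA hR hRA hc
  obtain ⟨T, hT, hT18, F, hFA, hFL, hF⟩ := hL G A R μ hA hμ hinv hμA hR hRA hc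
  have hT2 : T ^ 2 ⊆ A ^ 4 := ((symm_pow_mono hT (by norm_num : 2 ≤ 18)).trans hT18).trans hRA
  -- A * A is covered by K * L translates of T
  obtain ⟨E, hE, hEA⟩ := hA.2
  have hAA : A * A ⊆ ((E * F : Finset G) : Set G) * T := by
    refine hEA.trans ?_
    push_cast
    rw [mul_assoc]
    exact Set.mul_subset_mul_left hF
  have hEF : (E * F).card < K * L + 1 :=
    Nat.lt_succ_of_le (Finset.card_mul_le.trans (Nat.mul_le_mul hE hFL))
  -- the set S
  refine ⟨{x | ∀ h ∈ F, h⁻¹ * x * h ∈ T ^ 2}, ?_, ⟨?_, ?_⟩, ?_, ?_⟩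
  · intro x hx
    obtain ⟨f, hf, t, ht, hft⟩ := hF hA.1.1
    have hfF : f ∈ F := by exact_mod_cast hf
    have hfA := hFA hf
    have h1 := hT2 (hx f hfF)
    have h2 : x ∈ A * A ^ 4 * A :=
      ⟨f * (f⁻¹ * x * f), ⟨f, hfA, _, h1, rfl⟩, f⁻¹, hA.1.2 f hfA, by simp [mul_assoc]⟩
    rw [← pow_succ', ← pow_succ] at h2
    exact symm_pow_mono hA.1 (by norm_num) h2
  · intro h hh
    simpa using symm_pow_mono hT (by norm_num : 0 ≤ 2) (by simp)
  · intro x hx h hh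
    obtain ⟨a, ha, b, hb, hab⟩ := (pow_two T ▸ hx h hh : _ ∈ T * T)
    rw [pow_two]
    refine ⟨b⁻¹, hT.2 b hb, a⁻¹, hT.2 a ha, ?_⟩
    have := congrArg (·⁻¹) hab
    simpa [mul_assoc] using this
  · -- covering
    have hcov : ∀ a ∈ A, ∀ h ∈ F, ∃ j : Fin (K * L + 1), ∃ (hj : j.1 < (E * F).card),
        (((E * F).equivFin.symm ⟨j.1, hj⟩ : G))⁻¹ * (a * h) ∈ T := by
      intro a ha h hh
      obtain ⟨e, he, t, ht, het⟩ := hAA (Set.mul_mem_mul ha (hFA (by exact_mod_cast hh : h ∈ (F : Set G))))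
      have heF : e ∈ E * F := by exact_mod_cast he
      refine ⟨⟨((E * F).equivFin ⟨e, heF⟩).1, lt_trans (Fin.is_lt _) hEF⟩, ((E * F).equivFin ⟨e, heF⟩).2, ?_⟩
      simp only [Fin.eta, Equiv.symm_apply_apply]
      rw [← het]
      simpa using ht
    choose! j hj hjT using hcov
    let enc : G → (Fin L → Fin (K * L + 1)) := fun a i =>
      if hi : i.1 < F.card then j a (F.equivFin.symm ⟨i.1, hi⟩) else 0
    have henc : ∀ a b, enc a = enc b → ∀ h ∈ F, j a h = j b h := by
      intro a b hab h hh
      have := congrFun hab ⟨(F.equivFin ⟨h, hh⟩).1, lt_of_lt_of_le (Fin.is_lt _) hFL⟩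
      simpa [enc] using this
    have e0 : Fin ((K * L + 1) ^ L) ≃ (Fin L → Fin (K * L + 1)) :=
      (Fintype.equivFinOfCardEq (by simp)).symm
    refine ⟨fun i => if hi : ∃ a ∈ A, enc a = e0 i then hi.choose else 1, ?_⟩
    intro a ha
    refine Set.mem_iUnion.2 ⟨e0.symm (enc a), ?_⟩
    have hi : ∃ b ∈ A, enc b = e0 (e0.symm (enc a)) := ⟨a, ha, by simp⟩
    beta_reduce
    rw [dif_pos hi]
    obtain ⟨hbA, hb⟩ := hi.choose_spec
    set b := hi.choose with hbdef
    rw [Equiv.apply_symm_apply] at hb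
    rw [Set.mem_smul_set_iff_inv_smul_mem]
    intro h hh
    have h1 := hjT a ha h hh
    have h2 := hjT b hbA h hh
    have h3 := henc b a hb h hh
    simp only [h3] at h2
    rw [pow_two]
    refine ⟨_, hT.2 _ h2, _, h1, ?_⟩
    simp [mul_assoc]
  · intro a ha x hx
    obtain ⟨f, hf, t, ht, hft⟩ := hF (hA.1.2 a ha)
    have hfF : f ∈ F := by exact_mod_cast hf
    have h1 := pow_conj (T := T ^ 2) f⁻¹ (fun y hy => by simpa using hy f hfF) 8 x hx
    rw [← pow_mul] at h1
    have hat : a = t⁻¹ * f⁻¹ := by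
      have := congrArg (·⁻¹) hft
      simpa using this.symm
    apply hT18
    have h2 : a * x * a⁻¹ ∈ T * T ^ (2 * 8) * T :=
      ⟨t⁻¹ * (f⁻¹ * x * f⁻¹⁻¹), ⟨t⁻¹, hT.2 t ht, _, h1, rfl⟩, t, ht, by simp [hat, mul_assoc]⟩
    rwa [← pow_succ', ← pow_succ] at h2
end
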